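/- arXiv:1509.09314 — 3 statements merged into one kernel-verified Lean document; each statement's English description precedes it below -/
import Mathlib

section
/- Let G be a group acting cocompactly by isometries on a CAT(0) space X. If there exists α in the visual boundary ∂X such that G fixes α and some geodesic ray representing α is contracting, then every geodesic ray in X is contracting. -/
open Metric Set Filter

variable {X : Type*} [MetricSpace X]

/-- A metric space is CAT(0) if midpoints exist and satisfy the CN comparison inequality. -/
def IsCAT0 (X : Type*) [MetricSpace X] : Prop :=
  ∀ x y : X, ∃ m : X, dist x m = dist x y / 2 ∧ dist y m = dist x y / 2 ∧
    ∀ z : X, dist z m ^ 2 ≤ (dist z x ^ 2 + dist z y ^ 2) / 2 - dist x y ^ 2 / 4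

/-- A geodesic ray: isometric embedding of `[0, ∞)`. -/
def IsRay (c : ℝ → X) : Prop :=
  ∀ s t : ℝ, 0 ≤ s → 0 ≤ t → dist (c s) (c t) = |s - t|

/-- A bi-infinite geodesic: isometric embedding of `ℝ`. -/
def IsGeodesicLine (c : ℝ → X) : Prop :=
  ∀ s t : ℝ, dist (c s) (c t) = |s - t|

/-- A geodesic segment from `y` to `z`, parametrized on `[0, dist y z]`. -/
def IsGeodesicSeg (g : ℝ → X) (y z : X) : Prop :=
  g 0 = y ∧ g (dist y z) = z ∧
    ∀ s t, s ∈ Icc 0 (dist y z) → t ∈ Icc 0 (dist y z) → dist (g s) (g t) = |s - t|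

/-- `π` is a nearest-point projection onto the set `S`. -/
def IsProjOn (S : Set X) (π : X → X) : Prop :=
  ∀ p : X, π p ∈ S ∧ ∀ q ∈ S, dist p (π p) ≤ dist p q

/-- The set `S` (image of a geodesic) is `A`-contracting. -/
def ContractingSet (A : ℝ) (S : Set X) : Prop :=
  ∃ π : X → X, IsProjOn S π ∧
    ∀ p q : X, dist p q < dist p (π p) → dist (π p) (π q) < A

/-- Slimness with respect to a given nearest-point projection `π` onto `S`:
every geodesic from `y` to a point `z ∈ S` passes within `δ` of `π y`. -/
def SlimWith (δ : ℝ) (S : Set X) (π : X → X) : Prop :=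
  ∀ y z, z ∈ S → ∀ g : ℝ → X, IsGeodesicSeg g y z →
    ∃ s ∈ Icc (0:ℝ) (dist y z), dist (π y) (g s) ≤ δ

/-- The set `S` is `δ`-slim. -/
def SlimSet (δ : ℝ) (S : Set X) : Prop :=
  ∃ π : X → X, IsProjOn S π ∧ SlimWith δ S π

/-- Two rays are asymptotic (bounded Hausdorff distance). -/
def Asymp (a b : ℝ → X) : Prop :=
  ∃ M : ℝ, ∀ t : ℝ, 0 ≤ t → dist (a t) (b t) ≤ M

/-- Points of a geodesic at dyadic parameters, obtained by iterating midpoints. -/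
lemma IsCAT0.exists_dyadic (hX : IsCAT0 X) (n : ℕ) : ∀ k : ℕ, k ≤ 2 ^ n → ∀ p q : X,
    ∃ w, dist p w = k / 2 ^ n * dist p q ∧ dist w q = (1 - k / 2 ^ n) * dist p q := by
  induction n with
  | zero =>
    intro k hk p q
    have hk' : k = 0 ∨ k = 1 := by simp at hk; omega
    rcases hk' with rfl | rfl
    · exact ⟨p, by simp⟩
    · exact ⟨q, by simp⟩
  | succ n ih =>
    intro k hk p q
    obtain ⟨m, hpm, hqm, -⟩ := hX p q
    rw [dist_comm q m] at hqm
    have h2 : (2 : ℝ) ^ n ≠ 0 := by positivity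
    rcases le_total k (2 ^ n) with h | h
    · obtain ⟨w, hw1, hw2⟩ := ih k h p m
      have e1 : dist p w = k / 2 ^ (n + 1) * dist p q := by
        rw [hw1, hpm, pow_succ]; field_simp
      refine ⟨w, e1, le_antisymm ?_ ?_⟩
      · calc dist w q ≤ dist w m + dist m q := dist_triangle _ _ _
          _ = _ := by rw [hw2, hpm, hqm, pow_succ]; field_simp; ring
      · linarith [dist_triangle p w q]
    · obtain ⟨j, rfl⟩ := Nat.exists_eq_add_of_le h
      obtain ⟨w, hw1, hw2⟩ := ih j (by rw [pow_succ] at hk; omega) m q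
      have e2 : dist w q = (1 - (2 ^ n + j : ℕ) / 2 ^ (n + 1)) * dist p q := by
        rw [hw2, hqm, pow_succ]; push_cast; field_simp; ring
      refine ⟨w, le_antisymm ?_ ?_, e2⟩
      · calc dist p w ≤ dist p m + dist m w := dist_triangle _ _ _
          _ = _ := by rw [hw1, hpm, hqm, pow_succ]; push_cast; field_simp
      · linarith [dist_triangle p w q]

/-- In a proper CAT(0) space any two points are joined by points at every intermediate distance. -/
lemma IsCAT0.exists_between [ProperSpace X] (hX : IsCAT0 X) (p q : X) {t : ℝ} (ht0 : 0 ≤ t)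
    (ht1 : t ≤ dist p q) : ∃ w, dist p w = t ∧ dist w q = dist p q - t := by
  rcases (dist_nonneg (x := p) (y := q)).eq_or_lt with h0 | hL
  · exact ⟨p, by rw [dist_self]; linarith, by linarith⟩
  obtain ⟨w, -, hmin⟩ := (isCompact_closedBall p (dist p q)).exists_isMinOn
    ⟨p, mem_closedBall_self dist_nonneg⟩
    (f := fun w => |dist p w - t| + |dist w q - (dist p q - t)|) (by fun_prop)
  have key : |dist p w - t| + |dist w q - (dist p q - t)| ≤ 0 := by
    refine le_of_forall_pos_le_add fun ε hε => ?_
    obtain ⟨n, hn⟩ := pow_unbounded_of_one_lt (2 * dist p q / ε) (one_lt_two (α := ℝ))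
    have hp : (0 : ℝ) < 2 ^ n := by positivity
    have hx0 : 0 ≤ t / dist p q * 2 ^ n := by positivity
    have hk1 := Nat.floor_le hx0
    have hk2 := Nat.lt_floor_add_one (t / dist p q * 2 ^ n)
    set k := ⌊t / dist p q * 2 ^ n⌋₊
    have hk3 : k ≤ 2 ^ n := by
      have h1 : (k : ℝ) ≤ 2 ^ n :=
        hk1.trans (mul_le_of_le_one_left hp.le ((div_le_one hL).2 ht1))
      exact_mod_cast h1
    obtain ⟨v, hv1, hv2⟩ := hX.exists_dyadic n k hk3 p q
    have hd1 : (k : ℝ) / 2 ^ n * dist p q ≤ t := by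
      rw [div_mul_eq_mul_div, div_le_iff₀ hp]
      rw [div_mul_eq_mul_div, le_div_iff₀ hL] at hk1
      exact hk1
    have hd2 : t - ε / 2 ≤ (k : ℝ) / 2 ^ n * dist p q := by
      rw [div_lt_iff₀ hε] at hn
      rw [div_mul_eq_mul_div, le_div_iff₀ hp]
      rw [div_mul_eq_mul_div, div_lt_iff₀ hL] at hk2
      nlinarith
    have hv : v ∈ closedBall p (dist p q) := by
      rw [mem_closedBall, dist_comm]; linarith
    refine (hmin hv).trans ?_
    have e1 : |dist p v - t| ≤ ε / 2 := abs_le.2 ⟨by linarith, by linarith⟩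
    have e2 : |dist v q - (dist p q - t)| ≤ ε / 2 := abs_le.2 ⟨by linarith, by linarith⟩
    simp only
    linarith
  have h1 := abs_nonneg (dist p w - t)
  have h2 := abs_nonneg (dist w q - (dist p q - t))
  have h3 := abs_eq_zero.1 (le_antisymm (by linarith) h1)
  have h4 := abs_eq_zero.1 (le_antisymm (by linarith) h2)
  exact ⟨w, by linarith, by linarith⟩

/-- The projection to a contracting set is coarsely Lipschitz. -/
lemma dist_proj_le_add [ProperSpace X] (hX : IsCAT0 X) {A : ℝ} (hA : 0 < A) {π : X → X}
    (hc : ∀ p q : X, dist p q < dist p (π p) → dist (π p) (π q) < A) (u v : X) :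
    dist (π u) (π v) ≤ dist u v + 4 * A := by
  suffices H : ∀ n : ℕ, ∀ u v : X, dist u v ≤ n * A → dist (π u) (π v) ≤ dist u v + 4 * A by
    obtain ⟨n, hn⟩ := exists_nat_ge (dist u v / A)
    exact H n u v ((div_le_iff₀ hA).1 hn)
  intro n
  induction n with
  | zero =>
    intro u v h
    have : u = v := dist_le_zero.1 (by simpa using h)
    subst this
    simp; linarith
  | succ n ih =>
    have step : ∀ u v : X, dist u v ≤ (n + 1) * A → 2 * A < dist u (π u) →
        dist (π u) (π v) ≤ dist u v + 4 * A := by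
      intro u v h hu
      rcases le_total (dist u v) A with h1 | h1
      · linarith [hc u v (by linarith), dist_nonneg (x := u) (y := v)]
      · obtain ⟨w, hw1, hw2⟩ := hX.exists_between u v hA.le h1
        linarith [ih w v (by linarith), hc u w (by linarith), dist_triangle (π u) (π w) (π v)]
    intro u v h
    push_cast at h
    rcases lt_or_ge (2 * A) (dist u (π u)) with hu | hu
    · exact step u v h hu
    rcases lt_or_ge (2 * A) (dist v (π v)) with hv | hv
    · rw [dist_comm (π u), dist_comm u]
      exact step v u (by rwa [dist_comm]) hv
    · have := dist_triangle4 (π u) u v (π v)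
      rw [dist_comm (π u) u] at this
      linarith

/-- Points with distant projections to a contracting set are joined almost through
their projections. -/
lemma add_dist_proj_le [ProperSpace X] (hX : IsCAT0 X) {A : ℝ} (hA : 0 < A) {π : X → X}
    (hc : ∀ p q : X, dist p q < dist p (π p) → dist (π p) (π q) < A) (p q : X)
    (h : dist p (π p) + dist q (π q) ≤ dist p q ∨ 2 * A ≤ dist (π p) (π q)) :
    dist p (π p) + dist (π p) (π q) + dist q (π q) - 8 * A ≤ dist p q := by
  have hR : 0 ≤ dist p (π p) := dist_nonneg
  have hQ : 0 ≤ dist q (π q) := dist_nonneg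
  rcases le_or_gt (dist p (π p) + dist q (π q)) (dist p q) with h1 | h1
  · have near : ∀ u v : X, dist u (π u) ≤ dist u v → ∃ w, dist u w + dist w v = dist u v ∧
        dist u w ≤ dist u (π u) ∧ dist u (π u) - A ≤ dist u w ∧ dist (π u) (π w) ≤ A := by
      intro u v huv
      rcases le_or_gt (dist u (π u)) A with h2 | h2
      · exact ⟨u, by simp, by simp, by simpa using h2, by simpa using hA.le⟩
      · obtain ⟨w, hw1, hw2⟩ := hX.exists_between u v (t := dist u (π u) - A) (by linarith)
          (by linarith)
        exact ⟨w, by linarith, by linarith, by linarith, (hc u w (by linarith)).le⟩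
    obtain ⟨p', h2, h3, h4, h5⟩ := near p q (by linarith)
    obtain ⟨q', h6, h7, h8, h9⟩ := near q p' (by rw [dist_comm q p']; linarith)
    rw [dist_comm q p', dist_comm q' p'] at h6
    have h10 := dist_proj_le_add hX hA hc p' q'
    have h11 := dist_triangle4 (π p) (π p') (π q') (π q)
    rw [dist_comm (π q') (π q)] at h11
    linarith
  · exfalso
    replace h := h.resolve_left (by linarith)
    rcases lt_or_ge (dist p q) (dist p (π p)) with h2 | h2
    · linarith [hc p q h2]
    rcases lt_or_ge (dist p q) (dist q (π q)) with h3 | h3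
    · have := hc q p (by rwa [dist_comm])
      rw [dist_comm] at this
      linarith
    obtain ⟨w, hw1, hw2⟩ := hX.exists_between p q
      (t := (dist p (π p) + (dist p q - dist q (π q))) / 2) (by linarith) (by linarith)
    have h4 := hc p w (by linarith)
    have h5 := hc q w (by rw [dist_comm q w]; linarith)
    have := dist_triangle (π p) (π w) (π q)
    rw [dist_comm (π w) (π q)] at this
    linarith

/-- The hyperbolic three-point inequality based at a point far out along a contracting ray `a`,
when one of the three points is near the origin of `a`. -/
lemma eventually_three_point [ProperSpace X] (hX : IsCAT0 X) {A : ℝ} (hA : 0 < A) {a : ℝ → X}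
    (ha : IsRay a) {π : X → X} (hπ : IsProjOn (a '' Ici (0 : ℝ)) π)
    (hc : ∀ p q : X, dist p q < dist p (π p) → dist (π p) (π q) < A) {c : ℝ → X}
    (hca : Asymp c a) {D : ℝ} (p q r : X) (hr : dist r (a 0) ≤ D) :
    ∀ᶠ t in atTop, dist p q + dist r (c t) ≤
      max (dist p r + dist q (c t)) (dist q r + dist p (c t)) + (16 * A + 2 * D) := by
  obtain ⟨M, hM⟩ := hca
  have h0mem : a 0 ∈ a '' Ici (0 : ℝ) := ⟨0, self_mem_Ici, rfl⟩
  have hfix0 : π (a 0) = a 0 := by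
    have := (hπ (a 0)).2 _ h0mem
    rw [dist_self] at this
    exact (dist_le_zero.1 this).symm
  have origin : ∀ u : X, ∀ s : ℝ, 0 ≤ s → a s = π u → dist u (π u) + s - 8 * A - D ≤ dist u r := by
    intro u s hs hu
    have h1 := add_dist_proj_le hX hA hc u (a 0) (Or.inl (by
      rw [hfix0, dist_self, add_zero]; exact (hπ u).2 _ h0mem))
    rw [hfix0, dist_self] at h1
    have h2 : dist (π u) (a 0) = s := by rw [← hu, ha s 0 hs le_rfl, sub_zero, abs_of_nonneg hs]
    linarith [dist_triangle u r (a 0)]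
  obtain ⟨s, hs, hsp⟩ := (hπ p).1
  obtain ⟨s', hs', hsq⟩ := (hπ q).1
  rw [mem_Ici] at hs hs'
  filter_upwards [eventually_ge_atTop (s + s' + 2 * M + 2 * A), eventually_ge_atTop 0]
    with t ht ht0
  obtain ⟨τ, hτ, hτo⟩ := (hπ (c t)).1
  rw [mem_Ici] at hτ
  have hτt : t - 2 * M ≤ τ := by
    have h1 := (hπ (c t)).2 (a t) ⟨t, ht0, rfl⟩
    have h2 := hM t ht0
    have h3 := dist_triangle (a t) (c t) (π (c t))
    rw [← hτo, ha t τ ht0 hτ, dist_comm (a t) (c t), hτo] at h3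
    linarith [le_abs_self (t - τ)]
  have far : ∀ u : X, ∀ s : ℝ, 0 ≤ s → s + 2 * A ≤ τ → a s = π u →
      dist u (π u) + (τ - s) + dist (c t) (π (c t)) - 8 * A ≤ dist u (c t) := by
    intro u s hs hsτ hu
    have h1 : dist (π u) (π (c t)) = τ - s := by
      rw [← hu, ← hτo, ha s τ hs hτ, abs_sub_comm, abs_of_nonneg (by linarith)]
    have h2 := add_dist_proj_le hX hA hc u (c t) (Or.inr (by linarith))
    linarith
  have hp1 := origin p s hs hsp
  have hq1 := origin q s' hs' hsq
  have hp2 := far p s hs (by linarith) hsp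
  have hq2 := far q s' hs' (by linarith) hsq
  have hro := dist_triangle4 r (a 0) (π (c t)) (c t)
  have h0τ : dist (a 0) (π (c t)) = τ := by
    rw [← hτo, ha 0 τ le_rfl hτ, zero_sub, abs_neg, abs_of_nonneg hτ]
  rw [dist_comm (π (c t)) (c t)] at hro
  have hpq := dist_triangle4 p (π p) (π q) q
  have hss : dist (π p) (π q) = |s - s'| := by rw [← hsp, ← hsq, ha s s' hs hs']
  rw [dist_comm (π q) q] at hpq
  rcases abs_cases (s - s') with ⟨h, -⟩ | ⟨h, -⟩
  · have := le_max_left (dist p r + dist q (c t)) (dist q r + dist p (c t))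
    linarith
  · have := le_max_right (dist p r + dist q (c t)) (dist q r + dist p (c t))
    linarith

/-- The three-point inequality at a common base point `o` for all triples among four points
implies the four-point inequality. -/
lemma four_point_of_three_point {δ : ℝ} {o : X} {p q r s : X}
    (h : ∀ x ∈ ({p, q, r, s} : Set X), ∀ y ∈ ({p, q, r, s} : Set X), ∀ z ∈ ({p, q, r, s} : Set X),
      dist x y + dist z o ≤ max (dist x z + dist y o) (dist y z + dist x o) + δ) :
    dist p q + dist r s ≤ max (dist p r + dist q s) (dist p s + dist q r) + 2 * δ := by
  have h1 := h p (by simp) q (by simp) r (by simp)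
  have h2 := h p (by simp) q (by simp) s (by simp)
  have h3 := h r (by simp) s (by simp) p (by simp)
  have h4 := h r (by simp) s (by simp) q (by simp)
  rw [dist_comm r p, dist_comm s p] at h3
  rw [dist_comm r q, dist_comm s q] at h4
  simp only [max_def] at *
  split_ifs at * <;> linarith

/-- A geodesic ray in a proper space satisfying the four-point inequality is contracting. -/
lemma IsRay.contracting_of_four_point [ProperSpace X] {δ : ℝ} (hδ : 0 < δ)
    (h4 : ∀ p q r s : X,
      dist p q + dist r s ≤ max (dist p r + dist q s) (dist p s + dist q r) + δ)
    {b : ℝ → X} (hb : IsRay b) : ∃ B : ℝ, ContractingSet B (b '' Ici (0 : ℝ)) := by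
  have hclosed : IsClosed (b '' Ici (0 : ℝ)) := by
    have hiso : Isometry fun t : Ici (0 : ℝ) => b t :=
      Isometry.of_dist_eq fun s t => by rw [hb s t s.2 t.2, Subtype.dist_eq, Real.dist_eq]
    have : CompleteSpace (Ici (0 : ℝ)) := isClosed_Ici.completeSpace_coe
    rw [image_eq_range]
    exact hiso.isClosedEmbedding.isClosed_range
  have hne : (b '' Ici (0 : ℝ)).Nonempty := ⟨b 0, 0, self_mem_Ici, rfl⟩
  choose π hmem hdist using fun p => hclosed.exists_infDist_eq_dist hne p
  have hπ : IsProjOn (b '' Ici (0 : ℝ)) π := fun p =>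
    ⟨hmem p, fun q hq => by rw [← hdist p]; exact infDist_le_dist_of_mem hq⟩
  have through : ∀ p : X, ∀ z ∈ b '' Ici (0 : ℝ),
      dist p (π p) + dist (π p) z - 3 * δ ≤ dist p z := by
    intro p z hz
    have hle := (hπ p).2 z hz
    rcases le_or_gt (dist (π p) z) (2 * δ) with h1 | h1
    · linarith
    obtain ⟨w, hw, hw1, hw2⟩ : ∃ w ∈ b '' Ici (0 : ℝ), dist (π p) w = 2 * δ ∧
        dist w z = dist (π p) z - 2 * δ := by
      obtain ⟨s, hs, hsp⟩ := hmem p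
      obtain ⟨t, ht, rfl⟩ := hz
      rw [mem_Ici] at hs ht
      rw [← hsp, hb s t hs ht] at h1 ⊢
      rcases abs_cases (s - t) with ⟨h, -⟩ | ⟨h, -⟩
      · have h0 : 0 ≤ s - 2 * δ := by linarith
        refine ⟨b (s - 2 * δ), ⟨_, h0, rfl⟩, ?_, ?_⟩
        · rw [hb _ _ hs h0, abs_of_nonneg] <;> linarith
        · rw [hb _ _ h0 ht, h, abs_of_nonneg] <;> linarith
      · have h0 : 0 ≤ s + 2 * δ := by linarith
        refine ⟨b (s + 2 * δ), ⟨_, h0, rfl⟩, ?_, ?_⟩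
        · rw [hb _ _ hs h0, abs_of_nonpos] <;> linarith
        · rw [hb _ _ h0 ht, h, abs_of_nonpos] <;> linarith
    have h2 := h4 p w (π p) z
    have h3 := (hπ p).2 w hw
    rw [dist_comm w (π p)] at h2
    rcases max_cases (dist p (π p) + dist w z) (dist p z + dist (π p) w) with ⟨h, -⟩ | ⟨h, -⟩ <;>
      linarith
  refine ⟨7 * δ + 1, π, hπ, fun p q hpq => ?_⟩
  have h1 := through p (π q) (hmem q)
  have h2 := through q (π p) (hmem p)
  have h3 := h4 p (π q) q (π p)
  rw [dist_comm (π q) (π p), dist_comm (π q) q] at h3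
  rw [dist_comm (π q) (π p)] at h2
  have h5 : 0 ≤ dist q (π q) := dist_nonneg
  rcases max_cases (dist p q + dist (π p) (π q)) (dist p (π p) + dist q (π q))
    with ⟨h, -⟩ | ⟨h, -⟩
  · linarith
  · linarith

theorem fixed_implies_all_contracting [ProperSpace X] (hX : IsCAT0 X)
    (G : Type*) [Group G] [MulAction G X]
    (hiso : ∀ g : G, Isometry fun p : X => g • p)
    (x₀ : X) (hcc : ∃ C : ℝ, ∀ p : X, ∃ g : G, dist p (g • x₀) ≤ C)
    (a : ℝ → X) (ha : IsRay a)
    (hacontr : ∃ A : ℝ, ContractingSet A (a '' Ici (0:ℝ)))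
    (hfix : ∀ g : G, Asymp (fun t => g • a t) a) :
    ∀ b : ℝ → X, IsRay b → ∃ B : ℝ, ContractingSet B (b '' Ici (0:ℝ)) := by
  obtain ⟨C, hC⟩ := hcc
  obtain ⟨A₀, π, hπ, hc₀⟩ := hacontr
  set A := max A₀ 1
  have hA : 0 < A := lt_max_of_lt_right one_pos
  have hc : ∀ p q : X, dist p q < dist p (π p) → dist (π p) (π q) < A :=
    fun p q h => (hc₀ p q h).trans_le (le_max_left _ _)
  have hsmul : ∀ (g : G) (x y : X), dist (g • x) (g • y) = dist x y := fun g => (hiso g).dist_eq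
  set D := C + dist x₀ (a 0)
  have three : ∀ p q r : X, ∀ᶠ t in atTop, dist p q + dist r (a t) ≤
      max (dist p r + dist q (a t)) (dist q r + dist p (a t)) + (16 * A + 2 * D) := by
    intro p q r
    obtain ⟨g, hg⟩ := hC r
    have hr : dist (g⁻¹ • r) (a 0) ≤ D := by
      rw [← hsmul g, smul_inv_smul]
      have := dist_triangle r (g • x₀) (g • a 0)
      rw [hsmul] at this
      exact this.trans (add_le_add_left hg _)
    have := eventually_three_point hX hA ha hπ hc (hfix g⁻¹) (g⁻¹ • p) (g⁻¹ • q) (g⁻¹ • r) hr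
    simpa only [hsmul] using this
  have hD : 0 ≤ D := by
    obtain ⟨g, hg⟩ := hC x₀
    have := (dist_nonneg (x := x₀) (y := g • x₀)).trans hg
    positivity
  intro b hb
  refine hb.contracting_of_four_point (δ := 2 * (16 * A + 2 * D)) (by positivity) fun p q r s => ?_
  have hfin : ({p, q, r, s} : Set X).Finite := toFinite _
  have key := (hfin.eventually_all).2 fun x _ => (hfin.eventually_all).2 fun y _ =>
    (hfin.eventually_all).2 fun z _ => three x y z
  obtain ⟨t, ht⟩ := key.exists
  exact four_point_of_three_point ht
end

section
/- Let G act geometrically (properly discontinuously, cocompactly, by isometries) on a proper CAT(0) space X. If the contracting boundary ∂_c X has exactly two points, then X is quasi-isometric to the real line ℝ. -/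
open Metric Set Filter

variable {X : Type*} [MetricSpace X]

open Topology

/-! ### Geodesics -/

/-- Iterated midpoints: a chain of `2 ^ k` equal steps from `p` to `q`. -/
theorem IsCAT0.exists_chain (hX : IsCAT0 X) (k : ℕ) : ∀ p q : X, ∃ P : ℕ → X,
    P 0 = p ∧ P (2 ^ k) = q ∧ ∀ i < 2 ^ k, dist (P i) (P (i + 1)) ≤ dist p q / 2 ^ k := by
  induction k with
  | zero =>
    intro p q
    refine ⟨fun i => if i = 0 then p else q, by simp, by simp, ?_⟩
    intro i hi
    have : i = 0 := by simpa using hi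
    simp [this]
  | succ k ih =>
    intro p q
    obtain ⟨m, hpm, hqm, -⟩ := hX p q
    obtain ⟨P, hP0, hP1, hP⟩ := ih p m
    obtain ⟨Q, hQ0, hQ1, hQ⟩ := ih m q
    have hpos : 0 < 2 ^ k := by positivity
    refine ⟨fun i => if i < 2 ^ k then P i else Q (i - 2 ^ k), by simp [hP0], ?_, ?_⟩
    · have h1 : ¬ 2 ^ (k + 1) < 2 ^ k := by rw [pow_succ]; omega
      have h2 : 2 ^ (k + 1) - 2 ^ k = 2 ^ k := by rw [pow_succ]; omega
      simp [h1, h2, hQ1]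
    · intro i hi
      have hhalf : dist p q / 2 ^ (k + 1) = dist p q / 2 / 2 ^ k := by
        rw [pow_succ]; field_simp
      rw [hhalf]
      rw [pow_succ] at hi
      rcases lt_trichotomy (i + 1) (2 ^ k) with h | h | h
      · have h' : i < 2 ^ k := by omega
        simpa [h, h', hpm] using hP i h'
      · have h' : i < 2 ^ k := by omega
        have := hP i h'
        rw [h, hP1, hpm] at this
        simpa [h, h', hQ0] using this
      · have h1 : ¬ i + 1 < 2 ^ k := by omega
        have h2 : ¬ i < 2 ^ k := by omega
        have h3 : i + 1 - 2 ^ k = (i - 2 ^ k) + 1 := by omega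
        have := hQ (i - 2 ^ k) (by omega)
        rw [dist_comm m q, hqm] at this
        simpa [h1, h2, h3] using this

/-- A chain whose total length is the distance of its endpoints is isometrically embedded. -/
theorem dist_chain_eq {P : ℕ → X} {N : ℕ} {h : ℝ} (hP : ∀ i < N, dist (P i) (P (i + 1)) ≤ h)
    (hN : dist (P 0) (P N) = N * h) {i j : ℕ} (hi : i ≤ N) (hj : j ≤ N) :
    dist (P i) (P j) = |(i : ℝ) - j| * h := by
  have upper : ∀ i j : ℕ, i ≤ j → j ≤ N → dist (P i) (P j) ≤ ((j : ℝ) - i) * h := by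
    intro i j hij
    induction j, hij using Nat.le_induction with
    | base => intro _; simp
    | succ j hij ih =>
      intro hj
      have h1 := ih (by omega)
      have h2 := hP j (by omega)
      have h3 := dist_triangle (P i) (P j) (P (j + 1))
      push_cast
      linarith
  have main : ∀ i j : ℕ, i ≤ j → j ≤ N → dist (P i) (P j) = |(i : ℝ) - j| * h := by
    intro i j hij hj
    have h1 := upper 0 i (by omega) (by omega)
    have h2 := upper i j hij hj
    have h3 := upper j N hj le_rfl
    have h4 := dist_triangle4 (P 0) (P i) (P j) (P N)
    have h5 : |(i : ℝ) - j| = j - i := by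
      rw [abs_sub_comm, abs_of_nonneg]
      have : (i : ℝ) ≤ j := by exact_mod_cast hij
      linarith
    rw [h5]
    push_cast at h1
    linarith
  rcases le_total i j with hij | hij
  · exact main i j hij hj
  · rw [dist_comm, abs_sub_comm]
    exact main j i hij hi

/-- Pointwise limits of pointwise bounded sequences of maps along an ultrafilter. -/
theorem exists_pointwise_limit [ProperSpace X] (x : X) (f : ℕ → ℝ → X) (R : ℝ → ℝ)
    (h : ∀ n t, dist (f n t) x ≤ R t) :
    ∃ c : ℝ → X, ∀ t, Tendsto (fun n => f n t) (hyperfilter ℕ) (𝓝 (c t)) := by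
  have key : ∀ t, ∃ y, Tendsto (fun n => f n t) (hyperfilter ℕ) (𝓝 y) := by
    intro t
    obtain ⟨y, -, hy⟩ := (isCompact_closedBall x (R t)).ultrafilter_le_nhds
      ((hyperfilter ℕ).map fun n => f n t)
      (by
        rw [le_principal_iff]
        exact Filter.mem_map.2 (Filter.univ_mem' fun n => mem_closedBall.2 (h n t)))
    exact ⟨y, hy⟩
  choose c hc using key
  exact ⟨c, hc⟩

theorem IsCAT0.exists_geodesicSeg [ProperSpace X] (hX : IsCAT0 X) (p q : X) :
    ∃ g : ℝ → X, IsGeodesicSeg g p q := by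
  rcases eq_or_ne p q with rfl | hpq
  · refine ⟨fun _ => p, rfl, rfl, ?_⟩
    intro s t hs ht
    simp only [dist_self, Icc_self, mem_singleton_iff] at hs ht
    simp [hs, ht]
  have hL : 0 < dist p q := dist_pos.2 hpq
  set L := dist p q with hLdef
  choose P hP0 hP1 hP using fun k => hX.exists_chain k p q
  have hPd : ∀ k i j, i ≤ 2 ^ k → j ≤ 2 ^ k →
      dist (P k i) (P k j) = |(i : ℝ) - j| * (L / 2 ^ k) := by
    intro k i j hi hj
    refine dist_chain_eq (hP k) ?_ hi hj
    rw [hP0, hP1]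
    push_cast
    field_simp
  set idx : ℕ → ℝ → ℕ := fun k t => min (2 ^ k) ⌊t * 2 ^ k / L⌋₊ with hidx
  have hidx_le : ∀ k t, idx k t ≤ 2 ^ k := fun k t => min_le_left _ _
  have hidx_near : ∀ k t, t ∈ Icc 0 L → |(idx k t : ℝ) * (L / 2 ^ k) - t| ≤ L / 2 ^ k := by
    intro k t ht
    have hk : (0 : ℝ) < 2 ^ k := by positivity
    have h0 : 0 ≤ t * 2 ^ k / L := div_nonneg (mul_nonneg ht.1 hk.le) hL.le
    have h1 := Nat.floor_le h0
    have h2 := Nat.lt_floor_add_one (t * 2 ^ k / L)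
    have h3 : t * 2 ^ k / L ≤ 2 ^ k := by
      rw [div_le_iff₀ hL, mul_comm]
      exact mul_le_mul_of_nonneg_left ht.2 hk.le
    have h4 : ⌊t * 2 ^ k / L⌋₊ ≤ 2 ^ k := by
      have : (⌊t * 2 ^ k / L⌋₊ : ℝ) ≤ ((2 ^ k : ℕ) : ℝ) := by push_cast; linarith
      exact_mod_cast this
    have h5 : idx k t = ⌊t * 2 ^ k / L⌋₊ := min_eq_right h4
    rw [h5]
    have h6 : t = (t * 2 ^ k / L) * (L / 2 ^ k) := by field_simp
    have h7 : 0 < L / 2 ^ k := by positivity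
    rw [abs_le]
    constructor <;> nlinarith
  obtain ⟨c, hc⟩ := exists_pointwise_limit p (fun k t => P k (idx k t)) (fun _ => L) (by
    intro k t
    have h1 := hPd k (idx k t) 0 (hidx_le k t) (by positivity)
    rw [hP0] at h1
    rw [h1]
    have h2 : (idx k t : ℝ) ≤ 2 ^ k := by exact_mod_cast hidx_le k t
    have h3 : 0 < L / 2 ^ k := by positivity
    simp only [Nat.cast_zero, sub_zero, Nat.abs_cast]
    calc (idx k t : ℝ) * (L / 2 ^ k) ≤ 2 ^ k * (L / 2 ^ k) := by gcongr
      _ = L := by field_simp)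
  have hsmall : Tendsto (fun k : ℕ => 2 * (L / 2 ^ k)) (hyperfilter ℕ) (𝓝 0) := by
    have h1 : Tendsto (fun k : ℕ => 2 * L * (1 / 2 : ℝ) ^ k) atTop (𝓝 (2 * L * 0)) :=
      (tendsto_pow_atTop_nhds_zero_of_lt_one (by norm_num) (by norm_num)).const_mul _
    rw [mul_zero] at h1
    refine (h1.mono_left Nat.hyperfilter_le_atTop).congr fun k => ?_
    rw [one_div, inv_pow]; ring
  have hiso : ∀ s t, s ∈ Icc 0 L → t ∈ Icc 0 L → dist (c s) (c t) = |s - t| := by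
    intro s t hs ht
    refine tendsto_nhds_unique ((hc s).dist (hc t)) ?_
    rw [tendsto_iff_dist_tendsto_zero]
    refine squeeze_zero (fun _ => dist_nonneg) (fun k => ?_) hsmall
    rw [hPd k _ _ (hidx_le k s) (hidx_le k t), Real.dist_eq]
    have h7 : 0 < L / 2 ^ k := by positivity
    rw [← abs_of_pos h7, ← abs_mul, abs_of_pos h7]
    refine (abs_abs_sub_abs_le _ _).trans ?_
    have e1 := abs_le.1 (hidx_near k s hs)
    have e2 := abs_le.1 (hidx_near k t ht)
    rw [abs_le]
    constructor <;> nlinarith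
  refine ⟨c, ?_, ?_, hiso⟩
  · refine tendsto_nhds_unique (hc 0) ?_
    have : ∀ k, P k (idx k 0) = p := by intro k; simp [hidx, hP0]
    simp only [this]
    exact tendsto_const_nhds
  · refine tendsto_nhds_unique (hc L) ?_
    have : ∀ k, P k (idx k L) = q := by
      intro k
      have h1 : L * 2 ^ k / L = ((2 ^ k : ℕ) : ℝ) := by push_cast; field_simp
      have h2 : idx k L = 2 ^ k := by
        simp only [hidx]
        rw [h1, Nat.floor_natCast, min_self]
      rw [h2, hP1]
    simp only [this]
    exact tendsto_const_nhds

/-! ### Contracting rays -/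

/-- `u` is the parameter of a nearest-point projection to the ray `r`, and any two points whose
projections are more than `K` apart are joined through their projections, up to an error `K`. -/
structure IsStrongProj (K : ℝ) (r : ℝ → X) (u : X → ℝ) : Prop where
  ray : IsRay r
  const_nonneg : 0 ≤ K
  nonneg : ∀ p, 0 ≤ u p
  dist_le : ∀ p t, 0 ≤ t → dist p (r (u p)) ≤ dist p (r t)
  strong : ∀ p q, K < |u p - u q| →
    dist p (r (u p)) + |u p - u q| + dist q (r (u q)) ≤ dist p q + K

theorem dist_le_half_add {h : ℝ → ℝ} {A : ℝ} (hA : 0 < A) (n : ℕ) : ∀ {s t : ℝ}, s ≤ t →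
    (∀ x ∈ Icc s t, ∀ y ∈ Icc s t, |x - y| ≤ 2 * A → |h x - h y| ≤ A) →
    t - s ≤ 2 * A * n → |h s - h t| ≤ (t - s) / 2 + A := by
  induction n with
  | zero =>
    intro s t hst hh hn
    have : s = t := by simp at hn; linarith
    subst this
    simp [hA.le]
  | succ n ih =>
    intro s t hst hh hn
    by_cases hle : t - s ≤ 2 * A
    · have := hh s ⟨le_rfl, hst⟩ t ⟨hst, le_rfl⟩ (by rw [abs_sub_comm, abs_of_nonneg] <;> linarith)
      linarith
    · push Not at hle
      have h1 := hh s ⟨le_rfl, hst⟩ (s + 2 * A) ⟨by linarith, by linarith⟩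
        (by rw [abs_sub_comm, abs_of_nonneg] <;> linarith)
      have h2 := ih (s := s + 2 * A) (t := t) (by linarith)
        (fun x hx y hy => hh x ⟨by linarith [hx.1], hx.2⟩ y ⟨by linarith [hy.1], hy.2⟩)
        (by push_cast at hn; linarith)
      have h3 := abs_sub_le (h s) (h (s + 2 * A)) (h t)
      linarith

/-- A geodesic staying away from a contracting ray has a bounded projection. -/
theorem proj_bounded_of_far {r : ℝ → X} {u : X → ℝ} {A : ℝ} (hr : IsRay r) (hA : 0 < A)
    (hu : ∀ p, 0 ≤ u p)
    (hc : ∀ p q, dist p q < dist p (r (u p)) → |u p - u q| ≤ A)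
    {g : ℝ → X} {s t : ℝ} (hst : s ≤ t)
    (hg : ∀ x ∈ Icc s t, ∀ y ∈ Icc s t, dist (g x) (g y) = |x - y|)
    (hfar : ∀ x ∈ Icc s t, 4 * A ≤ dist (g x) (r (u (g x)))) :
    |u (g s) - u (g t)| ≤ 8 * A := by
  have hs : s ∈ Icc s t := ⟨le_rfl, hst⟩
  have ht : t ∈ Icc s t := ⟨hst, le_rfl⟩
  have hfs := hfar s hs
  have hft := hfar t ht
  set ds := dist (g s) (r (u (g s))) with hds
  set dt := dist (g t) (r (u (g t))) with hdt
  by_cases hcase : t - (dt - A) ≤ s + (ds - A)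
  · set w := min (s + (ds - A)) t with hw
    have hw1 : w ≤ s + (ds - A) := min_le_left _ _
    have hw2 : w ≤ t := min_le_right _ _
    have hw3 : s ≤ w := le_min (by linarith) hst
    have hw4 : t - dt < w := lt_min (by linarith) (by linarith)
    have hwm : w ∈ Icc s t := ⟨hw3, hw2⟩
    have h1 := hc (g s) (g w) (by
      rw [hg s hs w hwm, abs_sub_comm, abs_of_nonneg] <;> linarith)
    have h2 := hc (g t) (g w) (by
      rw [hg t ht w hwm, abs_of_nonneg] <;> linarith)
    have h3 := abs_sub_le (u (g s)) (u (g w)) (u (g t))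
    rw [abs_sub_comm (u (g w))] at h3
    linarith
  · push Not at hcase
    set x := s + (ds - A) with hx
    set y := t - (dt - A) with hy
    have hxm : x ∈ Icc s t := ⟨by linarith, by linarith⟩
    have hym : y ∈ Icc s t := ⟨by linarith, by linarith⟩
    have h1 := hc (g s) (g x) (by
      rw [hg s hs x hxm, abs_sub_comm, abs_of_nonneg] <;> linarith)
    have h2 := hc (g t) (g y) (by
      rw [hg t ht y hym, abs_of_nonneg] <;> linarith)
    obtain ⟨n, hn⟩ := exists_nat_ge ((y - x) / (2 * A))
    have h3 := dist_le_half_add (h := fun z => u (g z)) hA n hcase.le (by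
        intro z hz z' hz' hzz
        have hzm : z ∈ Icc s t := ⟨by linarith [hz.1, hxm.1], by linarith [hz.2, hym.2]⟩
        have hzm' : z' ∈ Icc s t := ⟨by linarith [hz'.1, hxm.1], by linarith [hz'.2, hym.2]⟩
        refine hc (g z) (g z') ?_
        rw [hg z hzm z' hzm']
        linarith [hfar z hzm])
      (by rw [div_le_iff₀ (by positivity)] at hn; linarith)
    have h4 := abs_sub_le (u (g s)) (u (g x)) (u (g t))
    have h5 := abs_sub_le (u (g x)) (u (g y)) (u (g t))
    rw [abs_sub_comm (u (g y)) (u (g t))] at h5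
    have h6 := dist_triangle4 (g s) (r (u (g s))) (r (u (g t))) (g t)
    rw [hg s hs t ht, hr _ _ (hu _) (hu _), dist_comm _ (g t), abs_sub_comm s t,
      abs_of_nonneg (by linarith : (0 : ℝ) ≤ t - s)] at h6
    linarith

theorem exists_strongProj_of_contracting [ProperSpace X] (hX : IsCAT0 X) {r : ℝ → X}
    (hr : IsRay r) (h : ∃ A : ℝ, ContractingSet A (r '' Ici (0 : ℝ))) :
    ∃ K u, IsStrongProj K r u := by
  obtain ⟨A₀, π, hπ, hcon⟩ := h
  choose u hu0 huπ using fun p => (hπ p).1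
  have hu : ∀ p, 0 ≤ u p := hu0
  have hle : ∀ p t, 0 ≤ t → dist p (r (u p)) ≤ dist p (r t) := by
    intro p t ht
    rw [huπ]
    exact (hπ p).2 _ ⟨t, ht, rfl⟩
  set A := max A₀ 1 with hAdef
  have hA : 0 < A := lt_of_lt_of_le one_pos (le_max_right _ _)
  have hc : ∀ p q, dist p q < dist p (r (u p)) → |u p - u q| ≤ A := by
    intro p q hpq
    rw [← hr _ _ (hu p) (hu q), huπ, huπ]
    rw [huπ] at hpq
    exact (hcon p q hpq).le.trans (le_max_left _ _)
  have hlip : ∀ p q, dist p (r (u p)) ≤ dist p q + dist q (r (u q)) := fun p q =>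
    (hle p _ (hu q)).trans (dist_triangle _ _ _)
  refine ⟨32 * A, u, hr, by positivity, hu, hle, ?_⟩
  intro p q hpq
  obtain ⟨g, hg0, hg1, hg⟩ := hX.exists_geodesicSeg p q
  set L := dist p q with hL
  have hL0 : 0 ≤ L := dist_nonneg
  have hcont : ContinuousOn (fun s => dist (g s) (r (u (g s)))) (Icc 0 L) := by
    have : LipschitzOnWith 1 (fun s => dist (g s) (r (u (g s)))) (Icc 0 L) := by
      refine LipschitzOnWith.of_le_add fun s hs t ht => ?_
      have := hlip (g s) (g t)
      rw [hg s t hs ht] at this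
      rw [Real.dist_eq]
      linarith
    exact this.continuousOn
  set T := Icc 0 L ∩ (fun s => dist (g s) (r (u (g s)))) ⁻¹' Iic (4 * A) with hT
  have hTc : IsCompact T := by
    refine isCompact_Icc.of_isClosed_subset
      (hcont.preimage_isClosed_of_isClosed isClosed_Icc isClosed_Iic) inter_subset_left
  have hTne : T.Nonempty := by
    by_contra hne
    rw [not_nonempty_iff_eq_empty] at hne
    have h8 := proj_bounded_of_far hr hA hu hc (g := g) hL0 (fun x hx y hy => hg x y hx hy)
      (fun x hx => by
        by_contra hlt
        push Not at hlt
        have : x ∈ T := ⟨hx, hlt.le⟩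
        rw [hne] at this
        exact this)
    rw [hg0, hg1] at h8
    linarith
  obtain ⟨s, hsT, hs⟩ := hTc.exists_isLeast hTne
  obtain ⟨t, htT, ht⟩ := hTc.exists_isGreatest hTne
  have hsI := hsT.1
  have htI := htT.1
  have hsd : dist (g s) (r (u (g s))) ≤ 4 * A := hsT.2
  have htd : dist (g t) (r (u (g t))) ≤ 4 * A := htT.2
  have hst : s ≤ t := hs htT
  have hps : |u p - u (g s)| ≤ 8 * A := by
    rcases hsI.1.eq_or_lt with h0 | h0
    · rw [← h0, hg0, sub_self, abs_zero]; positivity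
    rw [← hg0]
    refine proj_bounded_of_far hr hA hu hc h0.le
      (fun x hx y hy => hg x y ⟨hx.1, hx.2.trans hsI.2⟩ ⟨hy.1, hy.2.trans hsI.2⟩) ?_
    intro x hx
    by_contra hlt
    push Not at hlt
    have hxI : x ∈ Icc 0 L := ⟨hx.1, hx.2.trans hsI.2⟩
    have hsx : s = x := le_antisymm (hs ⟨hxI, hlt.le⟩) hx.2
    set e := 4 * A - dist (g x) (r (u (g x))) with he
    have hm1 : s - e ≤ max 0 (s - e) := le_max_right _ _
    have hm2 : max 0 (s - e) < s := max_lt h0 (by linarith)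
    have hmI : max 0 (s - e) ∈ Icc 0 L := ⟨le_max_left _ _, hm2.le.trans hsI.2⟩
    have := hlip (g (max 0 (s - e))) (g x)
    rw [hg _ _ hmI hxI, ← hsx, abs_sub_comm, abs_of_nonneg (by linarith)] at this
    rw [← hsx] at he
    have hmem : max 0 (s - e) ∈ T := ⟨hmI, by
      simp only [mem_preimage, mem_Iic]; linarith⟩
    linarith [hs hmem]
  have hqt : |u (g t) - u q| ≤ 8 * A := by
    rcases htI.2.eq_or_lt with h0 | h0
    · rw [h0, hg1, sub_self, abs_zero]; positivity
    rw [← hg1]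
    refine proj_bounded_of_far hr hA hu hc h0.le
      (fun x hx y hy => hg x y ⟨htI.1.trans hx.1, hx.2⟩ ⟨htI.1.trans hy.1, hy.2⟩) ?_
    intro x hx
    by_contra hlt
    push Not at hlt
    have hxI : x ∈ Icc 0 L := ⟨htI.1.trans hx.1, hx.2⟩
    have htx : t = x := le_antisymm hx.1 (ht ⟨hxI, hlt.le⟩)
    set e := 4 * A - dist (g x) (r (u (g x))) with he
    have hm1 : min L (t + e) ≤ t + e := min_le_right _ _
    have hm2 : t < min L (t + e) := lt_min h0 (by linarith)
    have hmI : min L (t + e) ∈ Icc 0 L := ⟨htI.1.trans hm2.le, min_le_left _ _⟩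
    have := hlip (g (min L (t + e))) (g x)
    rw [hg _ _ hmI hxI, ← htx, abs_of_nonneg (by linarith)] at this
    rw [← htx] at he
    have hmem : min L (t + e) ∈ T := ⟨hmI, by
      simp only [mem_preimage, mem_Iic]; linarith⟩
    linarith [ht hmem]
  have h1 := hlip p (g s)
  have h2 := hlip q (g t)
  have e1 : dist p (g s) = s := by
    conv_lhs => rw [← hg0]
    rw [hg 0 s ⟨le_rfl, hL0⟩ hsI, zero_sub, abs_neg, abs_of_nonneg hsI.1]
  have e2 : dist q (g t) = L - t := by
    conv_lhs => rw [← hg1]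
    rw [hg L t ⟨hL0, le_rfl⟩ htI, abs_of_nonneg (by linarith [htI.2])]
  have h3 := dist_triangle4 (r (u (g s))) (g s) (g t) (r (u (g t)))
  rw [hr _ _ (hu _) (hu _), dist_comm _ (g s), hg s t hsI htI, abs_sub_comm s t,
    abs_of_nonneg (by linarith : (0 : ℝ) ≤ t - s)] at h3
  have h4 := abs_sub_le (u p) (u (g s)) (u q)
  have h5 := abs_sub_le (u (g s)) (u (g t)) (u q)
  linarith

namespace IsStrongProj

variable {K : ℝ} {r : ℝ → X} {u : X → ℝ}

theorem proj_ray (h : IsStrongProj K r u) {t : ℝ} (ht : 0 ≤ t) : u (r t) = t := by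
  have h1 := h.dist_le (r t) t ht
  rw [dist_self, h.ray t _ ht (h.nonneg _)] at h1
  linarith [abs_nonpos_iff.1 h1]

theorem dist_ray (h : IsStrongProj K r u) (p : X) {t : ℝ} (ht : 0 ≤ t) :
    dist (r t) (r (u p)) = |t - u p| := h.ray t _ ht (h.nonneg p)

theorem smul {G : Type*} [Group G] [MulAction G X] (hiso : ∀ g : G, Isometry fun p : X => g • p)
    (h : IsStrongProj K r u) (g : G) :
    IsStrongProj K (fun t => g • r t) (fun p : X => u (g⁻¹ • p)) := by
  have hd : ∀ p q : X, dist p (g • q) = dist (g⁻¹ • p) q := by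
    intro p q
    have := (hiso g⁻¹).dist_eq p (g • q)
    simpa using this.symm
  refine ⟨?_, h.const_nonneg, fun p => h.nonneg _, ?_, ?_⟩
  · intro s t hs ht
    rw [(hiso g).dist_eq (r s) (r t)]
    exact h.ray s t hs ht
  · intro p t ht
    rw [hd, hd]
    exact h.dist_le _ t ht
  · intro p q hpq
    rw [hd, hd, ← (hiso g⁻¹).dist_eq p q]
    exact h.strong _ _ hpq

/-- A ray asymptotic to a contracting ray is contracting. -/
theorem contracting_of_asymp [ProperSpace X] (h : IsStrongProj K r u) {c : ℝ → X} (hc : IsRay c)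
    (hcr : Asymp c r) : ∃ A : ℝ, ContractingSet A (c '' Ici (0 : ℝ)) := by
  obtain ⟨M, hM⟩ := hcr
  have hclosed : IsClosed (c '' Ici (0 : ℝ)) := by
    have hi : Isometry fun t : Ici (0 : ℝ) => c t :=
      Isometry.of_dist_eq fun s t => by
        rw [hc s t s.2 t.2, Subtype.dist_eq, Real.dist_eq]
    have := isClosed_Ici.completeSpace_coe (s := Ici (0 : ℝ))
    have := hi.isClosedEmbedding.isClosed_range
    rwa [← image_eq_range] at this
  have hex : ∀ p, ∃ v, 0 ≤ v ∧ ∀ t, 0 ≤ t → dist p (c v) ≤ dist p (c t) := by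
    intro p
    obtain ⟨y, ⟨v, hv, rfl⟩, hy⟩ :=
      hclosed.exists_infDist_eq_dist ⟨c 0, 0, self_mem_Ici, rfl⟩ p
    refine ⟨v, hv, fun t ht => ?_⟩
    rw [← hy]
    exact infDist_le_dist_of_mem ⟨t, ht, rfl⟩
  choose v hv0 hv using hex
  have hnear : ∀ p, |v p - u p| ≤ 3 * M + K := by
    intro p
    have h1 := hv p (u p) (h.nonneg p)
    have h2 := hM (u p) (h.nonneg p)
    have h3 := hM (v p) (hv0 p)
    have h4 := h.dist_le (c (v p)) (v p) (hv0 p)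
    have h5 := dist_triangle_left (r (v p)) (r (u (c (v p)))) (c (v p))
    rw [h.dist_ray _ (hv0 p)] at h5
    have h6 := dist_triangle p (r (u p)) (c (u p))
    rw [dist_comm (r _)] at h6
    have h7 : |u p - u (c (v p))| ≤ M + K := by
      by_contra hlt
      push Not at hlt
      have hM0 : 0 ≤ M := dist_nonneg.trans h2
      have := h.strong p (c (v p)) (by linarith)
      have := dist_nonneg (x := c (v p)) (y := r (u (c (v p))))
      linarith
    have h8 := abs_sub_le (v p) (u (c (v p))) (u p)
    rw [abs_sub_comm (u (c (v p)))] at h8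
    linarith
  refine ⟨7 * M + 3 * K + 1, fun p => c (v p), fun p => ⟨⟨v p, hv0 p, rfl⟩, ?_⟩, ?_⟩
  · rintro q ⟨t, ht, rfl⟩
    exact hv p t ht
  · intro p q hpq
    rw [hc _ _ (hv0 p) (hv0 q)]
    have h1 := hv p (u p) (h.nonneg p)
    have h2 := hM (u p) (h.nonneg p)
    have h6 := dist_triangle p (r (u p)) (c (u p))
    rw [dist_comm (r _)] at h6
    have hM0 : 0 ≤ M := dist_nonneg.trans h2
    have h7 : |u p - u q| ≤ M + K := by
      by_contra hlt
      push Not at hlt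
      have := h.strong p q (by linarith)
      have := dist_nonneg (x := q) (y := r (u q))
      linarith
    have h8 := abs_sub_le (v p) (u p) (v q)
    have h9 := abs_sub_le (u p) (u q) (v q)
    have h10 := hnear q
    rw [abs_sub_comm] at h10
    linarith [hnear p]

/-- Points between a fixed point and a far away point of a contracting ray are near the ray. -/
theorem dist_le_of_between (h : IsStrongProj K r u) {x w : X} {t n : ℝ}
    (ht : dist x w = t) (hw : dist x w + dist w (r n) = dist x (r n))
    (hn : 2 * t + 2 * dist x (r 0) + K < n) :
    dist w (r t) ≤ 7 * dist x (r 0) + 4 * K := by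
  have hK := h.const_nonneg
  have ht0 : 0 ≤ t := ht ▸ dist_nonneg
  have hD : 0 ≤ dist x (r 0) := dist_nonneg
  have hn0 : 0 ≤ n := by linarith
  have hu := h.nonneg w
  have hux := h.nonneg x
  have hr0 : ∀ p, dist (r 0) (r (u p)) = u p := by
    intro p
    rw [h.dist_ray p le_rfl, zero_sub, abs_neg, abs_of_nonneg (h.nonneg p)]
  have a1 := h.dist_le w 0 le_rfl
  have a2 := dist_triangle w x (r 0)
  rw [dist_comm w x] at a2
  have a3 := dist_triangle (r 0) w (r (u w))
  rw [hr0, dist_comm (r 0)] at a3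
  have b1 := h.dist_le x 0 le_rfl
  have b2 := dist_triangle (r 0) x (r (u x))
  rw [hr0, dist_comm (r 0)] at b2
  have c1 := h.strong w (r n) (by
    rw [h.proj_ray hn0, abs_sub_comm, abs_of_nonneg] <;> linarith)
  rw [h.proj_ray hn0, dist_self, abs_sub_comm, abs_of_nonneg (by linarith)] at c1
  have c2 := dist_triangle x (r 0) (r n)
  rw [h.ray 0 n le_rfl hn0, zero_sub, abs_neg, abs_of_nonneg hn0] at c2
  have hd : dist w (r (u w)) ≤ 3 * dist x (r 0) + 2 * K := by
    by_cases hcase : K < |u x - u w|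
    · have d1 := h.strong x w hcase
      have d2 := neg_abs_le (u x - u w)
      have d3 := dist_nonneg (x := x) (y := r (u x))
      linarith
    · push Not at hcase
      have d2 := neg_abs_le (u x - u w)
      linarith
  have e1 := dist_triangle w (r (u w)) (r t)
  rw [dist_comm (r (u w)), h.dist_ray w ht0] at e1
  have e2 : |t - u w| ≤ dist x (r 0) + dist w (r (u w)) := by
    have f1 := dist_triangle4 x (r 0) (r (u w)) w
    rw [hr0, dist_comm (r (u w))] at f1
    have f2 := dist_triangle4 (r 0) x w (r (u w))
    rw [hr0, dist_comm (r 0)] at f2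
    rw [abs_le]
    constructor <;> linarith
  linarith

/-- Every contracting ray is asymptotic to a ray issuing from a given point. -/
theorem exists_ray_from [ProperSpace X] (hX : IsCAT0 X) (h : IsStrongProj K r u) (x : X) :
    ∃ c : ℝ → X, IsRay c ∧ c 0 = x ∧ Asymp c r := by
  choose g hg0 hg1 hg using fun n : ℕ => hX.exists_geodesicSeg x (r n)
  set clamp : ℕ → ℝ → ℝ := fun n t => max 0 (min t (dist x (r n))) with hclamp
  have hcI : ∀ (n : ℕ) (t : ℝ), clamp n t ∈ Icc 0 (dist x (r n)) := fun n t =>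
    ⟨le_max_left _ _, max_le dist_nonneg (min_le_right _ _)⟩
  have h0I : ∀ n : ℕ, (0 : ℝ) ∈ Icc 0 (dist x (r n)) := fun n => ⟨le_rfl, dist_nonneg⟩
  have hgx : ∀ (n : ℕ) (t : ℝ), t ∈ Icc 0 (dist x (r n)) → dist x (g n t) = t := by
    intro n t ht
    conv_lhs => rw [← hg0 n]
    rw [hg n 0 t (h0I n) ht, zero_sub, abs_neg, abs_of_nonneg ht.1]
  obtain ⟨c, hc⟩ := exists_pointwise_limit x (fun n t => g n (clamp n t)) (fun t => |t|) (by
    intro n t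
    rw [dist_comm, hgx n _ (hcI n t)]
    exact max_le (abs_nonneg t) ((min_le_left _ _).trans (le_abs_self t)))
  have hev : ∀ T : ℝ, ∀ᶠ n : ℕ in hyperfilter ℕ, T < n := fun T =>
    Nat.hyperfilter_le_atTop
      ((tendsto_natCast_atTop_atTop (R := ℝ)).eventually (eventually_gt_atTop T))
  have hlong : ∀ n : ℕ, (n : ℝ) - dist x (r 0) ≤ dist x (r n) := by
    intro n
    have h1 := dist_triangle_left (r 0) (r n) x
    rw [h.ray 0 n le_rfl (Nat.cast_nonneg n), zero_sub, abs_neg, Nat.abs_cast] at h1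
    linarith
  have hclamp_eq : ∀ (n : ℕ) (t : ℝ), 0 ≤ t → t + dist x (r 0) < n →
      clamp n t = t ∧ t ∈ Icc 0 (dist x (r n)) := by
    intro n t ht hn
    have h1 : t ≤ dist x (r n) := by linarith [hlong n]
    exact ⟨by simp [hclamp, h1, ht], ht, h1⟩
  refine ⟨c, ?_, ?_, 7 * dist x (r 0) + 4 * K, ?_⟩
  · intro s t hs ht
    refine tendsto_nhds_unique ((hc s).dist (hc t)) (tendsto_const_nhds.congr' ?_)
    filter_upwards [hev (s + dist x (r 0)), hev (t + dist x (r 0))] with n h1 h2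
    obtain ⟨e1, m1⟩ := hclamp_eq n s hs h1
    obtain ⟨e2, m2⟩ := hclamp_eq n t ht h2
    rw [e1, e2, hg n s t m1 m2]
  · refine tendsto_nhds_unique (hc 0) ?_
    have : ∀ n, g n (clamp n 0) = x := by
      intro n
      have : clamp n 0 = 0 := by simp [hclamp]
      rw [this, hg0]
    simp only [this]
    exact tendsto_const_nhds
  · intro t ht
    refine le_of_tendsto ((hc t).dist tendsto_const_nhds) ?_
    filter_upwards [hev (2 * t + 2 * dist x (r 0) + K)] with n h1
    have hD : 0 ≤ dist x (r 0) := dist_nonneg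
    obtain ⟨e1, m1⟩ := hclamp_eq n t ht (by linarith [h.const_nonneg])
    rw [e1]
    refine h.dist_le_of_between (hgx n t m1) ?_ h1
    rw [hgx n t m1]
    conv_lhs => rw [← hg1 n]
    rw [hg n t _ m1 ⟨dist_nonneg, le_rfl⟩, abs_sub_comm, abs_of_nonneg (by linarith [m1.2])]
    ring

/-- A ray with unbounded projection to a contracting ray is asymptotic to it. -/
theorem proj_bounded_of_not_asymp (h : IsStrongProj K r u) {b : ℝ → X} (hb : IsRay b)
    (h0 : b 0 = r 0) (hab : ¬ Asymp r b) : ∃ B : ℝ, 0 ≤ B ∧ ∀ t, 0 ≤ t → u (b t) ≤ B := by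
  by_contra hcon
  push Not at hcon
  refine hab ⟨4 * K, fun s hs => ?_⟩
  have hK := h.const_nonneg
  have hr0 : ∀ p, dist (r 0) (r (u p)) = u p := by
    intro p
    rw [h.dist_ray p le_rfl, zero_sub, abs_neg, abs_of_nonneg (h.nonneg p)]
  have hb0 : ∀ t, 0 ≤ t → dist (r 0) (b t) = t := by
    intro t ht
    rw [← h0, hb 0 t le_rfl ht, zero_sub, abs_neg, abs_of_nonneg ht]
  obtain ⟨t, ht, hlarge⟩ := hcon (4 * s + K) (by linarith)
  have a1 := h.dist_le (b s) 0 le_rfl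
  rw [dist_comm _ (r 0), hb0 s hs] at a1
  have a2 := dist_triangle (r 0) (b s) (r (u (b s)))
  rw [hr0, hb0 s hs] at a2
  have c1 := h.dist_le (b t) 0 le_rfl
  rw [dist_comm _ (r 0), hb0 t ht] at c1
  have c2 := dist_triangle (r 0) (b t) (r (u (b t)))
  rw [hr0, hb0 t ht] at c2
  have hst : s ≤ t := by linarith
  have a3 := h.strong (b s) (b t) (by
    rw [abs_sub_comm, abs_of_nonneg] <;> linarith)
  rw [hb s t hs ht, abs_sub_comm, abs_of_nonneg (by linarith), abs_sub_comm s t,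
    abs_of_nonneg (by linarith)] at a3
  have a4 := dist_triangle (r 0) (r (u (b t))) (b t)
  rw [hr0, hb0 t ht, dist_comm _ (b t)] at a4
  have hd : dist (b s) (r (u (b s))) ≤ 2 * K := by
    by_cases hv : u (b s) ≤ K
    · linarith
    · push Not at hv
      have := h.strong (b s) (r 0) (by
        rw [h.proj_ray le_rfl, sub_zero, abs_of_nonneg] <;> linarith)
      rw [h.proj_ray le_rfl, dist_self, sub_zero, abs_of_nonneg (h.nonneg _), dist_comm _ (r 0),
        hb0 s hs] at this
      linarith
  have e1 := dist_triangle (r s) (r (u (b s))) (b s)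
  rw [h.dist_ray _ hs, dist_comm (r (u (b s)))] at e1
  have e2 : |s - u (b s)| ≤ dist (b s) (r (u (b s))) := by
    have f1 := dist_triangle (r 0) (r (u (b s))) (b s)
    rw [hr0, hb0 s hs, dist_comm (r (u (b s)))] at f1
    rw [abs_le]
    constructor <;> linarith
  linarith

end IsStrongProj

theorem Asymp.symm {a b : ℝ → X} (h : Asymp a b) : Asymp b a := by
  obtain ⟨M, hM⟩ := h
  exact ⟨M, fun t ht => by rw [dist_comm]; exact hM t ht⟩

theorem Asymp.trans {a b c : ℝ → X} (h : Asymp a b) (h' : Asymp b c) : Asymp a c := by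
  obtain ⟨M, hM⟩ := h
  obtain ⟨N, hN⟩ := h'
  exact ⟨M + N, fun t ht => (dist_triangle _ (b t) _).trans (add_le_add (hM t ht) (hN t ht))⟩

theorem IsRay.dist_zero {a : ℝ → X} (ha : IsRay a) {t : ℝ} (ht : 0 ≤ t) :
    dist (a 0) (a t) = t := by
  rw [ha 0 t le_rfl ht, zero_sub, abs_neg, abs_of_nonneg ht]

/-- Two non-asymptotic contracting rays from a point form a quasi-geodesic line. -/
theorem IsStrongProj.le_dist_add {K B : ℝ} {a b : ℝ → X} {u : X → ℝ} (h : IsStrongProj K a u)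
    (hb : IsRay b) (h0 : b 0 = a 0) (hB : ∀ t, 0 ≤ t → u (b t) ≤ B) {s t : ℝ}
    (hs : 0 ≤ s) (ht : 0 ≤ t) : s + t ≤ dist (a s) (b t) + 2 * (B + K) := by
  have hK := h.const_nonneg
  have hBt := hB t ht
  have hu := h.nonneg (b t)
  have e1 := hb.dist_zero ht
  rw [h0] at e1
  by_cases hcase : B + K < s
  · have h1 := h.strong (a s) (b t) (by
      rw [h.proj_ray hs, abs_of_nonneg] <;> linarith)
    rw [h.proj_ray hs, dist_self, abs_of_nonneg (by linarith)] at h1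
    have h2 := dist_triangle (a 0) (a (u (b t))) (b t)
    rw [h.ray.dist_zero hu, dist_comm (a (u (b t))), e1] at h2
    linarith
  · push Not at hcase
    have h2 := dist_triangle (a 0) (a s) (b t)
    rw [h.ray.dist_zero hs] at h2
    linarith

/-- If `r` is a ray asymptotic to the contracting ray `a`, then far points of `r` are reached from
`r 0` through the projections to `a`. -/
theorem IsStrongProj.eventually_strong {K : ℝ} {a r : ℝ → X} {u : X → ℝ} (h : IsStrongProj K a u)
    (hra : Asymp r a) (p : X) : ∃ T : ℝ, ∀ n, T ≤ n → 0 ≤ n →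
      dist p (a (u p)) + (u (r n) - u p) + dist (r n) (a (u (r n))) ≤ dist p (r n) + K := by
  obtain ⟨M, hM⟩ := hra
  refine ⟨u p + 2 * M + K + 1, fun n hn hn0 => ?_⟩
  have h1 := hM n hn0
  have h2 := h.dist_le (r n) n hn0
  have h3 := dist_triangle_left (a n) (a (u (r n))) (r n)
  rw [h.dist_ray _ hn0] at h3
  have h4 := le_abs_self (n - u (r n))
  have h5 := le_abs_self (u (r n) - u p)
  rw [abs_sub_comm] at h5
  have h6 := h.strong p (r n) (by linarith)
  linarith

/-- The vertex of a quasi-geodesic line with the same ends as `a ∪ b` is uniformly close to it. -/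
theorem dist_le_of_asymp {K K' B E : ℝ} {a b r r' : ℝ → X} {u v : X → ℝ}
    (h : IsStrongProj K a u) (h' : IsStrongProj K' b v) (h0 : b 0 = a 0)
    (hB0 : 0 ≤ B) (hB : ∀ t, 0 ≤ t → u (b t) ≤ B) (hr : IsRay r) (hr' : IsRay r')
    (hrr : r 0 = r' 0) (hE0 : 0 ≤ E)
    (hE : ∀ n, 0 ≤ n → n + n ≤ dist (r n) (r' n) + E)
    (hra : Asymp r a) (hrb : Asymp r' b) :
    dist (r 0) (a (u (r 0))) ≤ E + 2 * K + 2 * K' + 2 * B ∨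
      dist (r 0) (b (v (r 0))) ≤ E + 2 * K + 2 * K' + 2 * B := by
  set p := r 0 with hp
  have hK := h.const_nonneg
  have hK' := h'.const_nonneg
  obtain ⟨T, hT⟩ := h.eventually_strong hra p
  obtain ⟨T', hT'⟩ := h'.eventually_strong hrb p
  have hu := h.nonneg p
  have hv := h'.nonneg p
  have key : dist p (a (u p)) + dist p (b (v p)) ≤ u p + v p + E + K + K' := by
    set n := max 0 (max T T') with hn
    have hn0 : 0 ≤ n := le_max_left _ _
    have h1 := hT n ((le_max_left _ _).trans (le_max_right _ _)) hn0
    have h2 := hT' n ((le_max_right _ _).trans (le_max_right _ _)) hn0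
    have h3 := hE n hn0
    rw [show dist p (r n) = n from hr.dist_zero hn0] at h1
    rw [show dist p (r' n) = n by rw [hrr, hr'.dist_zero hn0]] at h2
    have h4 := dist_triangle4 (r n) (a (u (r n))) (b (v (r' n))) (r' n)
    have h5 := dist_triangle (a (u (r n))) (a 0) (b (v (r' n)))
    rw [dist_comm _ (a 0), h.ray.dist_zero (h.nonneg _), ← h0,
      h'.ray.dist_zero (h'.nonneg _)] at h5
    rw [dist_comm (b _) (r' n)] at h4
    linarith
  have hda : 0 ≤ dist p (a (u p)) := dist_nonneg
  have hdb : 0 ≤ dist p (b (v p)) := dist_nonneg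
  by_cases hcase : B + K < u p
  · left
    have hw := hB (v p) hv
    have hw0 := h.nonneg (b (v p))
    have h1 := h.strong p (b (v p)) (by rw [abs_of_nonneg] <;> linarith)
    rw [abs_of_nonneg (by linarith)] at h1
    have h2 := dist_triangle (a 0) (a (u (b (v p)))) (b (v p))
    rw [h.ray.dist_zero hw0, dist_comm (a (u _)), ← h0, h'.ray.dist_zero hv] at h2
    linarith
  · right
    push Not at hcase
    by_cases hvK : v p ≤ K'
    · linarith
    · push Not at hvK
      have h1 := h'.strong p (b 0) (by
        rw [h'.proj_ray le_rfl, sub_zero, abs_of_nonneg] <;> linarith)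
      rw [h'.proj_ray le_rfl, dist_self, sub_zero, abs_of_nonneg hv, h0] at h1
      have h2 := dist_triangle p (a (u p)) (a 0)
      rw [dist_comm (a (u p)), h.ray.dist_zero hu] at h2
      linarith

theorem two_point_boundary_implies_qi_to_line [ProperSpace X] (hX : IsCAT0 X)
    (G : Type*) [Group G] [MulAction G X]
    (hiso : ∀ g : G, Isometry fun p : X => g • p)
    (x₀ : X) (hcc : ∃ C : ℝ, ∀ p : X, ∃ g : G, dist p (g • x₀) ≤ C)
    (hpd : ∀ p : X, ∀ r : ℝ, {g : G | dist p (g • p) ≤ r}.Finite)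
    (a b : ℝ → X) (ha : IsRay a) (hb : IsRay b) (ha0 : a 0 = x₀) (hb0 : b 0 = x₀)
    (hac : ∃ A : ℝ, ContractingSet A (a '' Ici (0:ℝ)))
    (hbc : ∃ B : ℝ, ContractingSet B (b '' Ici (0:ℝ)))
    (hab : ¬ Asymp a b)
    (honly : ∀ c : ℝ → X, IsRay c → c 0 = x₀ →
      (∃ A : ℝ, ContractingSet A (c '' Ici (0:ℝ))) → Asymp c a ∨ Asymp c b) :
    ∃ (f : ℝ → X) (Λ ε : ℝ), 1 ≤ Λ ∧ 0 ≤ ε ∧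
      (∀ s t : ℝ, |s - t| / Λ - ε ≤ dist (f s) (f t) ∧
        dist (f s) (f t) ≤ Λ * |s - t| + ε) ∧
      (∀ p : X, ∃ s : ℝ, dist p (f s) ≤ ε) := by
  obtain ⟨C, hC⟩ := hcc
  obtain ⟨K, u, hu⟩ := exists_strongProj_of_contracting hX ha hac
  obtain ⟨K', v, hv⟩ := exists_strongProj_of_contracting hX hb hbc
  have h0 : b 0 = a 0 := hb0.trans ha0.symm
  obtain ⟨B, hB0, hB⟩ := hu.proj_bounded_of_not_asymp hb h0 hab
  have hK := hu.const_nonneg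
  have hK' := hv.const_nonneg
  set E := 2 * (B + K) with hEdef
  have hE0 : 0 ≤ E := by positivity
  have hE : ∀ s t, 0 ≤ s → 0 ≤ t → s + t ≤ dist (a s) (b t) + E := fun s t hs ht =>
    hu.le_dist_add hb h0 hB hs ht
  have hend : ∀ (L : ℝ) (r : ℝ → X) (w : X → ℝ), IsStrongProj L r w → Asymp r a ∨ Asymp r b := by
    intro L r w hw
    obtain ⟨c, hc, hc0, hcr⟩ := hw.exists_ray_from hX x₀
    exact (honly c hc hc0 (hw.contracting_of_asymp hc hcr)).imp hcr.symm.trans hcr.symm.trans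
  set R := E + 2 * K + 2 * K' + 2 * B with hR
  have horbit : ∀ g : G, (∃ s, 0 ≤ s ∧ dist (g • x₀) (a s) ≤ R) ∨
      ∃ s, 0 ≤ s ∧ dist (g • x₀) (b s) ≤ R := by
    intro g
    have hga := hu.smul hiso g
    have hgb := hv.smul hiso g
    have hne : ¬ Asymp (fun t => g • a t) (fun t => g • b t) := by
      rintro ⟨M, hM⟩
      exact hab ⟨M, fun t ht => by rw [← (hiso g).dist_eq (a t) (b t)]; exact hM t ht⟩
    have hgE : ∀ n, 0 ≤ n → n + n ≤ dist (g • a n) (g • b n) + E := by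
      intro n hn
      rw [(hiso g).dist_eq (a n) (b n)]
      exact hE n n hn hn
    rcases hend _ _ _ hga with h1 | h1 <;> rcases hend _ _ _ hgb with h2 | h2
    · exact absurd (h1.trans h2.symm) hne
    · have := dist_le_of_asymp hu hv h0 hB0 hB hga.ray hgb.ray (by simp only [h0]) hE0 hgE h1 h2
      simp only [ha0] at this
      exact this.imp (fun h => ⟨_, hu.nonneg _, h⟩) fun h => ⟨_, hv.nonneg _, h⟩
    · have := dist_le_of_asymp hu hv h0 hB0 hB hgb.ray hga.ray (by simp only [h0]) hE0
        (fun n hn => by rw [dist_comm]; exact hgE n hn) h2 h1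
      simp only [hb0] at this
      exact this.imp (fun h => ⟨_, hu.nonneg _, h⟩) fun h => ⟨_, hv.nonneg _, h⟩
    · exact absurd (h1.trans h2.symm) hne
  have hC0 : 0 ≤ C := by
    obtain ⟨g, hg⟩ := hC x₀
    exact dist_nonneg.trans hg
  have hRE : E ≤ R := by rw [hR]; linarith
  refine ⟨fun t => if 0 ≤ t then a t else b (-t), 1, C + R, le_rfl, by linarith, ?_, ?_⟩
  · intro s t
    have hcross : ∀ s t : ℝ, 0 ≤ s → t < 0 →
        |s - t| ≤ dist (a s) (b (-t)) + E ∧ dist (a s) (b (-t)) ≤ |s - t| := by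
      intro s t hs ht
      have h1 := hE s (-t) hs (by linarith)
      have h2 := dist_triangle (a s) (a 0) (b (-t))
      rw [dist_comm _ (a 0), ha.dist_zero hs, ← h0,
        hb.dist_zero (by linarith : (0 : ℝ) ≤ -t)] at h2
      rw [abs_of_nonneg (by linarith)]
      constructor <;> linarith
    simp only [div_one, one_mul]
    by_cases hs : 0 ≤ s <;> by_cases ht : 0 ≤ t
    · simp only [hs, ht, if_true]
      rw [ha s t hs ht]
      constructor <;> linarith
    · simp only [hs, ht, if_true, if_false]
      have := hcross s t hs (by linarith)
      constructor <;> linarith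
    · simp only [hs, ht, if_true, if_false]
      have := hcross t s ht (by linarith)
      rw [dist_comm, abs_sub_comm]
      constructor <;> linarith
    · simp only [hs, ht, if_false]
      push Not at hs ht
      rw [hb _ _ (by linarith) (by linarith), neg_sub_neg, abs_sub_comm]
      constructor <;> linarith
  · intro p
    obtain ⟨g, hg⟩ := hC p
    rcases horbit g with ⟨s, hs, hd⟩ | ⟨s, hs, hd⟩
    · refine ⟨s, ?_⟩
      simp only [hs, if_true]
      exact (dist_triangle _ _ _).trans (add_le_add hg hd)
    · refine ⟨-s, ?_⟩
      have hval : (if 0 ≤ -s then a (-s) else b (- -s)) = b s := by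
        rcases hs.eq_or_lt with rfl | hs'
        · simp [h0]
        · rw [if_neg (by linarith), neg_neg]
      simp only [hval]
      exact (dist_triangle _ _ _).trans (add_le_add hg hd)
end

section
/- Let X be a complete proper CAT(0) space with a geometric action of a group G, and suppose the visual boundary ∂X equals the contracting boundary as sets (every geodesic ray in X is contracting). Then X contains no isometrically embedded Euclidean plane, and hence X is δ-hyperbolic. -/
open Metric Set Filter

variable {X : Type*} [MetricSpace X]

/-- All geodesic triangles in `X` are `δ`-thin. -/
def DeltaHyp (X : Type*) [MetricSpace X] (δ : ℝ) : Prop :=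
  ∀ p q r : X, ∀ g₁ g₂ g₃ : ℝ → X,
    IsGeodesicSeg g₁ p q → IsGeodesicSeg g₂ q r → IsGeodesicSeg g₃ p r →
    ∀ s ∈ Icc (0:ℝ) (dist p r),
      infDist (g₃ s) (g₁ '' Icc 0 (dist p q) ∪ g₂ '' Icc 0 (dist q r)) ≤ δ

theorem IsRay.of_flat {f : EuclideanSpace ℝ (Fin 2) → X} (hf : Isometry f) :
    IsRay fun t : ℝ => f !₂[t, 0] := by
  intro s t _ _
  simp [hf.dist_eq, EuclideanSpace.dist_eq, Real.dist_eq, Real.sqrt_sq_eq_abs]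

/-- The nearest-point projection of `f (a, h)` to the ray `f ([0, ∞) × {0})` is `f (a, 0)`. -/
theorem IsProjOn.flat_apply {f : EuclideanSpace ℝ (Fin 2) → X} (hf : Isometry f) {π : X → X}
    (hπ : IsProjOn ((fun t : ℝ => f !₂[t, 0]) '' Ici 0) π) {a : ℝ} (ha : 0 ≤ a) (h : ℝ) :
    π (f !₂[a, h]) = f !₂[a, 0] := by
  obtain ⟨⟨t, -, ht⟩, hmin⟩ := hπ (f !₂[a, h])
  have h1 := hmin (f !₂[a, 0]) ⟨a, ha, rfl⟩
  rw [← ht] at h1 ⊢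
  simp only [hf.dist_eq, EuclideanSpace.dist_eq, Fin.sum_univ_two, Real.dist_eq, sq_abs] at h1
  rw [Real.sqrt_le_sqrt_iff (by positivity)] at h1
  simp only [Matrix.cons_val_zero, Matrix.cons_val_one] at h1
  have h2 : a - t = 0 := pow_eq_zero_iff two_ne_zero |>.mp (by nlinarith [sq_nonneg (a - t)])
  rw [show t = a by linarith]

theorem not_contractingSet_flat {f : EuclideanSpace ℝ (Fin 2) → X} (hf : Isometry f) (A : ℝ) :
    ¬ ContractingSet A ((fun t : ℝ => f !₂[t, 0]) '' Ici 0) := by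
  rintro ⟨π, hπ, hA⟩
  set k := |A| + 1 with hk
  have hk0 : 0 < k := by positivity
  have h := hA (f !₂[k, 2 * k]) (f !₂[2 * k, 2 * k])
  rw [hπ.flat_apply hf hk0.le, hπ.flat_apply hf (by positivity)] at h
  simp only [hf.dist_eq, EuclideanSpace.dist_eq, Fin.sum_univ_two, Real.dist_eq, sq_abs,
    Matrix.cons_val_zero, Matrix.cons_val_one, sub_self, sub_zero, ne_eq, OfNat.ofNat_ne_zero,
    not_false_eq_true, zero_pow, add_zero, zero_add, Real.sqrt_sq_eq_abs] at h
  rw [show k - 2 * k = -k by ring, abs_neg, abs_of_pos hk0, abs_of_pos (by positivity)] at h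
  linarith [h (by linarith), le_abs_self A]

theorem IsProjOn.dist_eq_infDist {S : Set X} {π : X → X} (hπ : IsProjOn S π) (p : X) :
    dist p (π p) = infDist p S :=
  le_antisymm ((le_infDist ⟨_, (hπ p).1⟩).2 fun {_} hq => (hπ p).2 _ hq)
    (infDist_le_dist_of_mem (hπ p).1)

theorem dist_proj_le_of_far_chain {π : X → X} {A : ℝ} (hA : 0 < A)
    (hc : ∀ p q : X, dist p q < dist p (π p) → dist (π p) (π q) < A)
    {g : ℝ → X} {L : ℝ} (hg : ∀ s ∈ Icc 0 L, ∀ t ∈ Icc 0 L, dist (g s) (g t) = |s - t|)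
    (hfar : ∀ t ∈ Icc 0 L, 4 * A ≤ dist (g t) (π (g t))) (n : ℕ) :
    ∀ s t, 0 ≤ s → s ≤ t → t ≤ L → t - s ≤ n * (2 * A) →
      dist (π (g s)) (π (g t)) ≤ n * A := by
  induction n with
  | zero =>
    intro s t _ hst _ h
    obtain rfl : s = t := by simp at h; linarith
    simp
  | succ n ih =>
    intro s t hs hst ht h
    push_cast at h ⊢
    set u := max s (t - 2 * A) with hu
    have hsu : s ≤ u := le_max_left _ _
    have hut : u ≤ t := max_le hst (by linarith)
    have h1 := ih s u hs hsu (hut.trans ht) (by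
      rw [sub_le_iff_le_add]
      exact max_le (by nlinarith [mul_nonneg n.cast_nonneg hA.le]) (by linarith))
    have h2 : dist (π (g u)) (π (g t)) < A := by
      have hu' : u ∈ Icc 0 L := ⟨hs.trans hsu, hut.trans ht⟩
      apply hc
      rw [hg u hu' t ⟨hs.trans hst, ht⟩, abs_sub_comm, abs_of_nonneg (by linarith)]
      linarith [hfar u hu', le_max_right s (t - 2 * A)]
    linarith [dist_triangle (π (g s)) (π (g u)) (π (g t))]

/-- A geodesic that stays far from a contracting set has small projection to it. -/
theorem dist_proj_le_of_far {π : X → X} {A : ℝ} (hA : 0 < A)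
    (hc : ∀ p q : X, dist p q < dist p (π p) → dist (π p) (π q) < A)
    {g : ℝ → X} {L : ℝ} (hL : 0 ≤ L)
    (hg : ∀ s ∈ Icc 0 L, ∀ t ∈ Icc 0 L, dist (g s) (g t) = |s - t|)
    (hfar : ∀ t ∈ Icc 0 L, 4 * A ≤ dist (g t) (π (g t))) :
    dist (π (g 0)) (π (g L)) ≤ 8 * A := by
  have m0 : (0 : ℝ) ∈ Icc 0 L := ⟨le_rfl, hL⟩
  have mL : L ∈ Icc 0 L := ⟨hL, le_rfl⟩
  have hR := hfar 0 m0
  have hR' := hfar L mL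
  set R := dist (g 0) (π (g 0))
  set R' := dist (g L) (π (g L))
  set h := dist (π (g 0)) (π (g L)) with hh
  have hstart : ∀ t ∈ Icc 0 L, t ≤ R - A → dist (π (g 0)) (π (g t)) < A := by
    intro t ht htR
    apply hc
    rw [hg 0 m0 t ht, zero_sub, abs_neg, abs_of_nonneg ht.1]
    linarith
  have hend : ∀ t ∈ Icc 0 L, L - t ≤ R' - A → dist (π (g t)) (π (g L)) < A := by
    intro t ht htR
    rw [dist_comm]
    apply hc
    rw [hg L mL t ht, abs_of_nonneg (by linarith [ht.2])]
    linarith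
  by_cases h1 : L ≤ R - A
  · linarith [hstart L mL h1]
  by_cases h2 : L ≤ R' - A
  · linarith [hend 0 m0 (by linarith)]
  push Not at h1 h2
  have mu : R - A ∈ Icc 0 L := ⟨by linarith, h1.le⟩
  have mv : L - (R' - A) ∈ Icc 0 L := ⟨by linarith, by linarith⟩
  have hv := hend _ mv (by linarith)
  by_cases h3 : L - (R' - A) ≤ R - A
  · linarith [hstart _ mv h3, dist_triangle (π (g 0)) (π (g (L - (R' - A)))) (π (g L))]
  push Not at h3
  have hu := hstart _ mu le_rfl
  have hLle : L ≤ R + h + R' := by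
    have h0 : dist (g 0) (g L) = L := by
      rw [hg 0 m0 L mL, zero_sub, abs_neg, abs_of_nonneg hL]
    have := dist_triangle4 (g 0) (π (g 0)) (π (g L)) (g L)
    rw [dist_comm (π (g L)) (g L)] at this
    linarith
  have hh0 : 0 ≤ h := dist_nonneg
  have hn1 := Nat.le_ceil ((h + 2 * A) / (2 * A))
  have hn2 := Nat.ceil_lt_add_one (a := (h + 2 * A) / (2 * A)) (by positivity)
  set n := ⌈(h + 2 * A) / (2 * A)⌉₊
  rw [div_le_iff₀ (by positivity)] at hn1
  have hn3 : (n : ℝ) * (2 * A) ≤ h + 4 * A := by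
    rw [← sub_lt_iff_lt_add, lt_div_iff₀ (by positivity)] at hn2
    linarith
  have hmid := dist_proj_le_of_far_chain hA hc hg hfar n (R - A) (L - (R' - A)) mu.1 h3.le mv.2
    (by linarith)
  linarith [dist_triangle4 (π (g 0)) (π (g (R - A))) (π (g (L - (R' - A)))) (π (g L))]

/-- Bounded geodesic image: a geodesic whose endpoints project far apart to a contracting set
passes close to the projection of its starting point. -/
theorem exists_dist_proj_le {S : Set X} {π : X → X} (hπ : IsProjOn S π) {A : ℝ} (hA : 0 < A)
    (hc : ∀ p q : X, dist p q < dist p (π p) → dist (π p) (π q) < A)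
    {g : ℝ → X} {y z : X} (hg : IsGeodesicSeg g y z) (hyz : 8 * A < dist (π y) (π z)) :
    ∃ t ∈ Icc 0 (dist y z), dist (π y) (g t) ≤ 12 * A := by
  obtain ⟨h0, h1, hd⟩ := hg
  set L := dist y z
  have hL : 0 ≤ L := dist_nonneg
  have hcont : ContinuousOn (fun t => infDist (g t) S) (Icc 0 L) := by
    refine (continuous_infDist_pt S).comp_continuousOn ?_
    refine LipschitzOnWith.continuousOn (K := 1) (LipschitzOnWith.of_dist_le_mul ?_)
    intro s hs t ht
    rw [hd s t hs ht, Real.dist_eq]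
    simp
  set B := {t | t ∈ Icc 0 L ∧ infDist (g t) S ≤ 4 * A} with hB
  have hBc : IsClosed B := hcont.preimage_isClosed_of_isClosed isClosed_Icc isClosed_Iic
  have hBne : B.Nonempty := by
    by_contra hne
    have := dist_proj_le_of_far hA hc hL (fun s hs t ht => hd s t hs ht) fun t ht => by
      by_contra! hlt
      exact hne ⟨t, ht, by rw [← hπ.dist_eq_infDist]; exact hlt.le⟩
    rw [h0, h1] at this
    linarith
  have hBb : BddBelow B := ⟨0, fun t ht => ht.1.1⟩
  obtain ⟨mT, hT⟩ : sInf B ∈ B := hBc.csInf_mem hBne hBb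
  set T := sInf B
  rw [← hπ.dist_eq_infDist] at hT
  refine ⟨T, mT, ?_⟩
  have hproj : dist (π y) (π (g T)) ≤ 8 * A := by
    rcases mT.1.eq_or_lt with hT0 | hT0
    · rw [← hT0, h0, dist_self]
      positivity
    have hsub : Icc 0 T ⊆ Icc 0 L := Icc_subset_Icc_right mT.2
    rw [← h0]
    refine dist_proj_le_of_far hA hc mT.1
      (fun s hs t ht => hd s t (hsub hs) (hsub ht)) ?_
    have hge : ∀ t ∈ Ico 0 T, 4 * A ≤ infDist (g t) S := fun t ht => by
      by_contra! hlt
      exact absurd (csInf_le hBb ⟨hsub ⟨ht.1, ht.2.le⟩, hlt.le⟩) (not_le.mpr ht.2)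
    intro t ht
    rw [hπ.dist_eq_infDist]
    rw [← closure_Ico hT0.ne] at ht
    refine ContinuousWithinAt.closure_le ht continuousWithinAt_const
      ((hcont.mono ?_) t ?_ |>.mono Ico_subset_Icc_self) hge
    · exact hsub
    · rwa [closure_Ico hT0.ne] at ht
  have := dist_triangle (π y) (π (g T)) (g T)
  rw [dist_comm (π (g T)) (g T)] at this
  linarith

/-- A geodesic from `q`, projecting to the origin of a contracting ray, to a point `p` lying
far out in the direction of the ray passes close to the origin of the ray. -/
theorem IsRay.exists_dist_origin_le {c : ℝ → X} (hray : IsRay c) {π : X → X}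
    (hπ : IsProjOn (c '' Ici 0) π) {A : ℝ} (hA : 0 < A)
    (hc : ∀ p q : X, dist p q < dist p (π p) → dist (π p) (π q) < A)
    {p q v w : X} {g : ℝ → X} (hg : IsGeodesicSeg g q p) (hq : π q = c 0)
    {K : ℝ} (hK : 8 * A + 2 < K) (hv : dist v (c 0) ≤ 1) (hw : dist w (c K) ≤ 1)
    (hvw : dist p w + K = dist p v) :
    ∃ t ∈ Icc 0 (dist q p), dist (c 0) (g t) ≤ 12 * A := by
  rw [← hq]
  refine exists_dist_proj_le hπ hA hc hg ?_
  obtain ⟨⟨a, ha, hpa⟩, hmin⟩ := hπ p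
  have h1 := hmin (c K) ⟨K, mem_Ici.mpr (by linarith), rfl⟩
  have h2 : dist (c 0) (c a) = a := by
    rw [hray 0 a le_rfl ha, zero_sub, abs_neg, abs_of_nonneg ha]
  rw [hq, ← hpa, h2]
  rw [← hpa] at h1
  have h3 := dist_triangle p w (c K)
  have h4 := dist_triangle4 p (c a) (c 0) v
  rw [dist_comm (c a), h2, dist_comm (c 0) v] at h4
  linarith

theorem IsCAT0.dist_sq_line_le (hX : IsCAT0 X) {l : ℝ → X} (hl : IsGeodesicLine l) (q : X)
    (t h : ℝ) : dist q (l t) ^ 2 ≤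
      (dist q (l (t - h)) ^ 2 + dist q (l (t + h)) ^ 2) / 2 - h ^ 2 := by
  obtain ⟨m, -, -, hm⟩ := hX (l (t - h)) (l (t + h))
  have hlen : dist (l (t - h)) (l (t + h)) ^ 2 = 4 * h ^ 2 := by
    rw [hl, sq_abs]
    ring
  have hmt : l t = m := by
    have := hm (l t)
    rw [hlen, hl, hl, sq_abs, sq_abs] at this
    exact dist_eq_zero.mp (pow_eq_zero_iff two_ne_zero |>.mp
      (by nlinarith [sq_nonneg (dist (l t) m)]))
  have := hm q
  rw [hlen] at this
  rw [hmt]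
  linarith

theorem IsGeodesicLine.continuous {l : ℝ → X} (hl : IsGeodesicLine l) : Continuous l :=
  (Isometry.of_dist_eq fun s t => by rw [hl, Real.dist_eq]).continuous

/-- One of the projections of a point to the two halves of a line is the origin of the line. -/
theorem IsCAT0.proj_half_line_eq (hX : IsCAT0 X) {l : ℝ → X} (hl : IsGeodesicLine l)
    {π π' : X → X} (hπ : IsProjOn (l '' Ici 0) π)
    (hπ' : IsProjOn ((fun t => l (-t)) '' Ici 0) π') (q : X) : π q = l 0 ∨ π' q = l 0 := by
  obtain ⟨⟨a, ha, hqa⟩, hmin⟩ := hπ q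
  obtain ⟨⟨b, hb, hqb⟩, hmin'⟩ := hπ' q
  have h1 := hmin (l 0) ⟨0, self_mem_Ici, rfl⟩
  have h2 := hmin' (l 0) ⟨0, self_mem_Ici, by simp⟩
  rw [← hqa] at h1 ⊢
  rw [← hqb] at h2 ⊢
  rcases (mem_Ici.mp ha).eq_or_lt with rfl | ha
  · exact .inl rfl
  rcases (mem_Ici.mp hb).eq_or_lt with rfl | hb
  · exact .inr (by simp)
  exfalso
  have no_max : ∀ t ∈ Ioo (-b) a, ∃ u ∈ Icc (-b) a, dist q (l t) < dist q (l u) := by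
    intro t ht
    by_contra! hmax
    obtain ⟨e, he, he1, he2⟩ : ∃ e > 0, e ≤ t + b ∧ e ≤ a - t :=
      ⟨min (t + b) (a - t), lt_min (by linarith [ht.1]) (by linarith [ht.2]),
        min_le_left _ _, min_le_right _ _⟩
    have h3 := hmax (t - e) ⟨by linarith, by linarith⟩
    have h4 := hmax (t + e) ⟨by linarith, by linarith⟩
    have h5 := hX.dist_sq_line_le hl q t e
    have h6 := pow_le_pow_left₀ dist_nonneg h3 2
    have h7 := pow_le_pow_left₀ dist_nonneg h4 2
    nlinarith
  obtain ⟨T, hT, hmax⟩ := isCompact_Icc.exists_isMaxOn (s := Icc (-b) a)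
    ⟨0, by linarith, by linarith⟩ (continuous_const.dist hl.continuous |>.continuousOn :
      ContinuousOn (fun t => dist q (l t)) _)
  have hmax : ∀ u ∈ Icc (-b) a, dist q (l u) ≤ dist q (l T) := hmax
  obtain ⟨u, hu, hlt⟩ := no_max 0 ⟨by linarith, by linarith⟩
  obtain ⟨v, hv, hlt'⟩ := no_max T ⟨lt_of_le_of_ne hT.1 (by rintro rfl; linarith [hmax u hu]),
    lt_of_le_of_ne hT.2 (by rintro rfl; linarith [hmax u hu])⟩
  linarith [hmax v hv]

/-- Pointwise ultralimits of longer and longer geodesics through a bounded region are lines. -/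
theorem exists_line_ultralimit [ProperSpace X] (U : Ultrafilter ℕ) (hU : (U : Filter ℕ) ≤ atTop)
    {γ : ℕ → ℝ → X} {a b : ℕ → ℝ} (ha : ∀ n, n ≤ a n) (hb : ∀ n, n ≤ b n)
    (hγ : ∀ n, ∀ s ∈ Icc (-a n) (b n), ∀ t ∈ Icc (-a n) (b n),
      dist (γ n s) (γ n t) = |s - t|)
    {x₀ : X} {C : ℝ} (hC : ∀ n, dist x₀ (γ n 0) ≤ C) :
    ∃ l : ℝ → X, IsGeodesicLine l ∧ ∀ t, Tendsto (fun n => γ n t) U (nhds (l t)) := by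
  have hmem : ∀ t : ℝ, ∀ᶠ n in (U : Filter ℕ), t ∈ Icc (-a n) (b n) := by
    intro t
    filter_upwards [hU (eventually_ge_atTop ⌈|t|⌉₊)] with n hn
    have h1 := (Nat.le_ceil |t|).trans (Nat.cast_le.mpr hn)
    exact ⟨by linarith [neg_abs_le t, ha n], by linarith [le_abs_self t, hb n]⟩
  have hlim : ∀ t : ℝ, ∃ y, Tendsto (fun n => γ n t) U (nhds y) := by
    intro t
    obtain ⟨y, -, hy⟩ := (isCompact_closedBall x₀ (C + |t|)).ultrafilter_le_nhds'
      (U.map fun n => γ n t) (by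
        rw [Ultrafilter.mem_map]
        filter_upwards [hmem t, hmem 0] with n h1 h2
        rw [mem_preimage, mem_closedBall, dist_comm]
        have := hγ n 0 h2 t h1
        rw [zero_sub, abs_neg] at this
        linarith [dist_triangle x₀ (γ n 0) (γ n t), hC n])
    exact ⟨y, hy⟩
  choose l hl using hlim
  refine ⟨l, fun s t => ?_, hl⟩
  refine tendsto_nhds_unique ((hl s).dist (hl t)) (tendsto_const_nhds.congr' ?_)
  filter_upwards [hmem s, hmem t] with n h1 h2 using (hγ n s h1 t h2).symm

theorem IsGeodesicSeg.reverse {g : ℝ → X} {y z : X} (hg : IsGeodesicSeg g y z) :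
    IsGeodesicSeg (fun t => g (dist y z - t)) z y := by
  obtain ⟨h0, h1, hd⟩ := hg
  unfold IsGeodesicSeg
  rw [dist_comm z y]
  refine ⟨by simpa using h1, by simpa using h0, fun s t hs ht => ?_⟩
  rw [hd _ _ ⟨by linarith [hs.2], by linarith [hs.1]⟩ ⟨by linarith [ht.2], by linarith [ht.1]⟩,
    ← abs_neg]
  ring_nf

theorem IsGeodesicSeg.comp_isometry {g : ℝ → X} {y z : X} (hg : IsGeodesicSeg g y z)
    {φ : X → X} (hφ : Isometry φ) : IsGeodesicSeg (φ ∘ g) (φ y) (φ z) := by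
  obtain ⟨h0, h1, hd⟩ := hg
  unfold IsGeodesicSeg
  rw [hφ.dist_eq]
  exact ⟨by simp [h0], by simp [h1], fun s t hs ht => by simp [hφ.dist_eq, hd s t hs ht]⟩

/-- A triangle that is not `N`-thin, moved by an isometry and with its fat side parametrized
around a point far from the other two sides. -/
theorem exists_fat_triangle {x₀ : X} {C : ℝ}
    (hcc : ∀ p : X, ∃ φ : X → X, Isometry φ ∧ dist x₀ (φ p) ≤ C)
    {N : ℝ} (hN : ¬ DeltaHyp X N) :
    ∃ (γ : ℝ → X) (a b : ℝ) (q : X) (g₁ g₂ : ℝ → X), N ≤ a ∧ N ≤ b ∧ 0 ≤ a ∧ 0 ≤ b ∧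
      dist x₀ (γ 0) ≤ C ∧
      (∀ s ∈ Icc (-a) b, ∀ t ∈ Icc (-a) b, dist (γ s) (γ t) = |s - t|) ∧
      IsGeodesicSeg g₁ q (γ (-a)) ∧ IsGeodesicSeg g₂ q (γ b) ∧
      (∀ t ∈ Icc 0 (dist q (γ (-a))), N < dist (γ 0) (g₁ t)) ∧
      (∀ t ∈ Icc 0 (dist q (γ b)), N < dist (γ 0) (g₂ t)) := by
  unfold DeltaHyp at hN
  push Not at hN
  obtain ⟨p, q, r, g₁, g₂, g₃, h₁, h₂, h₃, s, hs, hfat⟩ := hN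
  obtain ⟨φ, hφ, hC⟩ := hcc (g₃ s)
  have hfar : ∀ x ∈ g₁ '' Icc 0 (dist p q) ∪ g₂ '' Icc 0 (dist q r), N < dist (g₃ s) x :=
    fun x hx => hfat.trans_le (infDist_le_dist_of_mem hx)
  have m0 : (0 : ℝ) ∈ Icc 0 (dist p r) := ⟨le_rfl, dist_nonneg⟩
  have mL : dist p r ∈ Icc 0 (dist p r) := ⟨dist_nonneg, le_rfl⟩
  have hp : N < s := by
    have := hfar p (.inl ⟨0, ⟨le_rfl, dist_nonneg⟩, h₁.1⟩)
    rwa [← h₃.1, h₃.2.2 s 0 hs m0, sub_zero, abs_of_nonneg hs.1] at this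
  have hr : N < dist p r - s := by
    have := hfar r (.inr ⟨dist q r, ⟨dist_nonneg, le_rfl⟩, h₂.2.1⟩)
    nth_rw 1 [← h₃.2.1] at this
    rwa [h₃.2.2 s _ hs mL, abs_sub_comm, abs_of_nonneg (by linarith [hs.2])] at this
  have ea : φ (g₃ (s + -s)) = φ p := by rw [add_neg_cancel, h₃.1]
  have eb : φ (g₃ (s + (dist p r - s))) = φ r := by rw [add_sub_cancel, h₃.2.1]
  refine ⟨fun t => φ (g₃ (s + t)), s, dist p r - s, φ q, φ ∘ fun t => g₁ (dist p q - t), φ ∘ g₂,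
    hp.le, hr.le, hs.1, by linarith [hs.2], by simpa using hC, ?_, ?_, ?_, ?_, ?_⟩
  · intro u hu v hv
    rw [hφ.dist_eq, h₃.2.2 _ _ ⟨by linarith [hu.1], by linarith [hu.2]⟩
      ⟨by linarith [hv.1], by linarith [hv.2]⟩, add_sub_add_left_eq_sub]
  · simp only [ea]
    exact h₁.reverse.comp_isometry hφ
  · simp only [eb]
    exact h₂.comp_isometry hφ
  · intro t ht
    simp only [ea, hφ.dist_eq, Function.comp_apply, add_zero] at ht ⊢
    rw [dist_comm q p] at ht
    exact hfar _ (.inl ⟨_, ⟨by linarith [ht.2], by linarith [ht.1]⟩, rfl⟩)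
  · intro t ht
    simp only [eb, hφ.dist_eq, Function.comp_apply, add_zero] at ht ⊢
    exact hfar _ (.inr ⟨t, ht, rfl⟩)

theorem ContractingSet.exists_pos {A : ℝ} {S : Set X} (h : ContractingSet A S) :
    ∃ π : X → X, IsProjOn S π ∧ ∃ B : ℝ, 0 < B ∧
      ∀ p q : X, dist p q < dist p (π p) → dist (π p) (π q) < B := by
  obtain ⟨π, hπ, hA⟩ := h
  exact ⟨π, hπ, max A 1, by positivity, fun p q hpq => (hA p q hpq).trans_le (le_max_left _ _)⟩

/-- A proper cocompact CAT(0) space all of whose rays are contracting is hyperbolic. -/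
theorem IsCAT0.exists_deltaHyp [ProperSpace X] (hX : IsCAT0 X) {x₀ : X} {C : ℝ}
    (hcc : ∀ p : X, ∃ φ : X → X, Isometry φ ∧ dist x₀ (φ p) ≤ C)
    (hall : ∀ c : ℝ → X, IsRay c → ∃ A : ℝ, ContractingSet A (c '' Ici (0 : ℝ))) :
    ∃ δ : ℝ, DeltaHyp X δ := by
  by_contra! hhyp
  choose γ a b q g₁ g₂ ha hb _ _ hC hγ hg₁ hg₂ hf₁ hf₂ using
    fun n : ℕ => exists_fat_triangle hcc (hhyp n)
  have hU : (hyperfilter ℕ : Filter ℕ) ≤ atTop := Nat.hyperfilter_le_atTop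
  obtain ⟨l, hl, hlim⟩ := exists_line_ultralimit (hyperfilter ℕ) hU ha hb hγ hC
  have hray : IsRay l := fun s t _ _ => hl s t
  have hray' : IsRay fun t => l (-t) := fun s t _ _ => by
    rw [hl, ← abs_neg]
    ring_nf
  obtain ⟨_, hA⟩ := hall _ hray
  obtain ⟨_, hA'⟩ := hall _ hray'
  obtain ⟨π, hπ, A, hA0, hA⟩ := hA.exists_pos
  obtain ⟨π', hπ', A', hA0', hA'⟩ := hA'.exists_pos
  have hnear : ∀ t, ∀ᶠ n in (hyperfilter ℕ : Filter ℕ), dist (γ n t) (l t) ≤ 1 := fun t =>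
    (tendsto_iff_dist_tendsto_zero.mp (hlim t)).eventually_le_const one_pos
  set K := 8 * A + 3 with hK
  set K' := 8 * A' + 3 with hK'
  obtain ⟨n, h0, h1, h2, hn⟩ := ((hnear 0).and <| (hnear K).and <| (hnear (-K')).and <|
    hU (eventually_ge_atTop ⌈12 * A + 12 * A' + 4⌉₊)).exists
  have hn := (Nat.le_ceil _).trans (Nat.cast_le (α := ℝ).mpr hn)
  have han := ha n
  have hbn := hb n
  have m0 : (0 : ℝ) ∈ Icc (-a n) (b n) := ⟨by linarith, by linarith⟩
  rcases hX.proj_half_line_eq hl hπ hπ' (q n) with hq | hq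
  · obtain ⟨t, ht, hle⟩ := hray.exists_dist_origin_le hπ hA0 hA (hg₂ n) hq (K := K)
      (by linarith) h0 h1 (by
        have mb : b n ∈ Icc (-a n) (b n) := ⟨by linarith, le_rfl⟩
        rw [hγ n _ mb K ⟨by linarith, by linarith⟩, hγ n _ mb _ m0, abs_of_nonneg (by linarith),
          abs_of_nonneg (by linarith)]
        ring)
    linarith [hf₂ n t ht, dist_triangle (γ n 0) (l 0) (g₂ n t)]
  · obtain ⟨t, ht, hle⟩ := hray'.exists_dist_origin_le hπ' hA0' hA' (hg₁ n)
      (hq.trans (by simp)) (K := K') (by linarith) (by simpa using h0) h2 (by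
        have ma : -a n ∈ Icc (-a n) (b n) := ⟨le_rfl, by linarith⟩
        rw [hγ n _ ma (-K') ⟨by linarith, by linarith⟩, hγ n _ ma _ m0,
          abs_of_nonpos (by linarith), abs_of_nonpos (by linarith)]
        ring)
    rw [neg_zero] at hle
    linarith [hf₁ n t ht, dist_triangle (γ n 0) (l 0) (g₁ n t)]

theorem no_flat_and_hyperbolic [ProperSpace X] [CompleteSpace X] (hX : IsCAT0 X)
    (G : Type*) [Group G] [MulAction G X]
    (hiso : ∀ g : G, Isometry fun p : X => g • p)
    (x₀ : X) (hcc : ∃ C : ℝ, ∀ p : X, ∃ g : G, dist p (g • x₀) ≤ C)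
    (hpd : ∀ p : X, ∀ r : ℝ, {g : G | dist p (g • p) ≤ r}.Finite)
    (hall : ∀ c : ℝ → X, IsRay c → ∃ A : ℝ, ContractingSet A (c '' Ici (0:ℝ))) :
    (¬ ∃ f : EuclideanSpace ℝ (Fin 2) → X, Isometry f) ∧ ∃ δ : ℝ, DeltaHyp X δ := by
  constructor
  · rintro ⟨f, hf⟩
    obtain ⟨A, hA⟩ := hall _ (IsRay.of_flat hf)
    exact not_contractingSet_flat hf A hA
  · obtain ⟨C, hC⟩ := hcc
    refine hX.exists_deltaHyp (x₀ := x₀) (C := C) (fun p => ?_) hall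
    obtain ⟨g, hg⟩ := hC p
    refine ⟨fun x => g⁻¹ • x, hiso g⁻¹, ?_⟩
    have := (hiso g⁻¹).dist_eq p (g • x₀)
    simp only [inv_smul_smul] at this
    rwa [dist_comm, this]
end
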